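/- arXiv:math/0601208 — 4 statements merged into one kernel-verified Lean document; each statement's English description precedes it below -/
import Mathlib

section
/- Proposition 4.3 (global gradient bound): Let Ω ⊂ ℝ^m be a bounded domain and ε > 0. Let F⃗ = (F₁,…,F_m) ∈ C¹(Ω) satisfy ∂_K F_I = ∂_I f_K on Ω for all I, K ∈ {1,…,m}, where f₁,…,f_m are bounded C¹ functions on Ω. Suppose u is C² on Ω, u and ∇u extend continuously to the closure Ω̄, and Q_ε u = H₀ in Ω for some constant H₀. Then for every K ∈ {1,…,m}: sup_{x∈Ω} |∂_K u(x)| ≤ sup_{x∈∂Ω} |∂_K u(x)| + 2 sup_{x∈Ω} |f_K(x)|, where ∂_K u on ∂Ω denotes the continuous extension. -/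
open MeasureTheory
open scoped RealInnerProductSpace ENNReal

/-- The elliptic approximating operator
`Q_ε v = div((∇v + F⃗)/√(ε² + |∇v + F⃗|²))`, the classical divergence of the vector
field `(∇v + F⃗)/√(ε² + |∇v + F⃗|²)`. -/
noncomputable def Qeps {m : ℕ} (ε : ℝ)
    (F : EuclideanSpace ℝ (Fin m) → EuclideanSpace ℝ (Fin m))
    (v : EuclideanSpace ℝ (Fin m) → ℝ) (x : EuclideanSpace ℝ (Fin m)) : ℝ :=
  ∑ i, fderiv ℝ
    (fun y => (Real.sqrt (ε ^ 2 + ‖gradient v y + F y‖ ^ 2))⁻¹ • (gradient v y + F y))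
    x (EuclideanSpace.single i 1) i

open Filter Topology

/-- The derivative at `0` of `t ↦ ∫ Y (x + t e) g x` is `∫ (∂_e Y) g`. -/
theorem hasDerivAt_integral_translate_mul {m : ℕ} {Y g : EuclideanSpace ℝ (Fin m) → ℝ}
    (hY : ContDiff ℝ 1 Y) (hYs : HasCompactSupport Y) (hg : Continuous g)
    (hgs : HasCompactSupport g) (e : EuclideanSpace ℝ (Fin m)) :
    HasDerivAt (fun t : ℝ => ∫ x, Y (x + t • e) * g x) (∫ x, fderiv ℝ Y x e * g x) 0 := by
  have hYd : Continuous (fderiv ℝ Y) := hY.continuous_fderiv one_ne_zero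
  obtain ⟨C, hC⟩ := (hYs.fderiv ℝ).exists_bound_of_continuous hYd
  have key := (hasDerivAt_integral_of_dominated_loc_of_deriv_le (μ := volume)
    (F := fun (t : ℝ) x => Y (x + t • e) * g x)
    (F' := fun t x => fderiv ℝ Y (x + t • e) e * g x)
    (bound := fun x => C * ‖e‖ * ‖g x‖) (x₀ := (0 : ℝ)) (s := Set.univ) univ_mem
    ?_ ?_ ?_ ?_ ?_ ?_).2
  · simpa using key
  · refine Eventually.of_forall fun t => Continuous.aestronglyMeasurable ?_
    have := hY.continuous
    fun_prop
  · refine Continuous.integrable_of_hasCompactSupport ?_ hgs.mul_left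
    have := hY.continuous
    fun_prop
  · refine Continuous.aestronglyMeasurable ?_
    fun_prop
  · refine Eventually.of_forall fun x t _ => ?_
    rw [norm_mul]
    gcongr
    exact (ContinuousLinearMap.le_opNorm _ _).trans (by gcongr; exact hC _)
  · exact (hg.norm.integrable_of_hasCompactSupport hgs.norm).const_mul _
  · refine Eventually.of_forall fun x t _ => ?_
    have h1 : HasDerivAt (fun t : ℝ => x + t • e) e t := by
      simpa using ((hasDerivAt_id t).smul_const e).const_add x
    exact ((hY.differentiable one_ne_zero _).hasFDerivAt.comp_hasDerivAt t h1).mul_const _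

/-- A vector field of constant divergence has weakly divergence-free directional derivatives. -/
theorem integral_fderiv_mul_fderiv_eq_zero_of_div_const {m : ℕ}
    {Y : Fin m → EuclideanSpace ℝ (Fin m) → ℝ} {φ : EuclideanSpace ℝ (Fin m) → ℝ}
    {U : Set (EuclideanSpace ℝ (Fin m))} {H : ℝ}
    (hY : ∀ i, ContDiff ℝ 1 (Y i)) (hYs : ∀ i, HasCompactSupport (Y i))
    (hφ : ContDiff ℝ 1 φ) (hφs : HasCompactSupport φ) (hU : IsOpen U) (hφU : tsupport φ ⊆ U)
    (hdiv : ∀ x ∈ U, ∑ i, fderiv ℝ (Y i) x (EuclideanSpace.single i 1) = H)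
    (e : EuclideanSpace ℝ (Fin m)) :
    ∫ x, ∑ i, fderiv ℝ (Y i) x e * fderiv ℝ φ x (EuclideanSpace.single i 1) = 0 := by
  have hφd : Continuous (fderiv ℝ φ) := hφ.continuous_fderiv one_ne_zero
  have hYd : ∀ i, Continuous (fderiv ℝ (Y i)) := fun i => (hY i).continuous_fderiv one_ne_zero
  have hgs : ∀ i : Fin m, HasCompactSupport fun x => fderiv ℝ φ x (EuclideanSpace.single i 1) :=
    fun i => hφs.fderiv_apply ℝ _
  have hder : HasDerivAt (fun t : ℝ => ∑ i, ∫ x, Y i (x + t • e) *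
      fderiv ℝ φ x (EuclideanSpace.single i 1))
      (∑ i, ∫ x, fderiv ℝ (Y i) x e * fderiv ℝ φ x (EuclideanSpace.single i 1)) 0 :=
    HasDerivAt.fun_sum fun i _ => hasDerivAt_integral_translate_mul (hY i) (hYs i)
      (by fun_prop) (hgs i) e
  have hmem : ∀ᶠ t : ℝ in 𝓝 0, ∀ x ∈ tsupport φ, x + t • e ∈ U := by
    refine IsCompact.eventually_forall_of_forall_eventually hφs fun x hx => ?_
    have hc : ContinuousAt (fun z : ℝ × EuclideanSpace ℝ (Fin m) => z.2 + z.1 • e) (0, x) := by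
      fun_prop
    exact hc.eventually_mem (by simpa using hU.mem_nhds (hφU hx))
  have hconst : (fun t : ℝ => ∑ i, ∫ x, Y i (x + t • e) *
      fderiv ℝ φ x (EuclideanSpace.single i 1)) =ᶠ[𝓝 0] fun _ => -∫ x, H * φ x := by
    filter_upwards [hmem] with t ht
    have hfd : ∀ i x, fderiv ℝ (fun x => Y i (x + t • e)) x = fderiv ℝ (Y i) (x + t • e) :=
      fun i x => fderiv_comp_add_right _
    have hYc : ∀ i, ContDiff ℝ 1 (fun x => Y i (x + t • e)) := fun i =>
      (hY i).comp (contDiff_id.add contDiff_const)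
    have hinteg : ∀ i : Fin m, Integrable fun x =>
        fderiv ℝ (Y i) (x + t • e) (EuclideanSpace.single i 1) * φ x := fun i =>
      Continuous.integrable_of_hasCompactSupport
        (by have := hφ.continuous; have := hYd i; fun_prop) hφs.mul_left
    have hibp : ∀ i, ∫ x, Y i (x + t • e) * fderiv ℝ φ x (EuclideanSpace.single i 1) =
        -∫ x, fderiv ℝ (Y i) (x + t • e) (EuclideanSpace.single i 1) * φ x := by
      intro i
      have := integral_mul_fderiv_eq_neg_fderiv_mul_of_integrable (μ := volume)
        (f := fun x => Y i (x + t • e)) (g := φ) (v := EuclideanSpace.single i 1)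
        (by simpa only [hfd] using hinteg i)
        (Continuous.integrable_of_hasCompactSupport
          (by have := (hYc i).continuous; fun_prop) (hgs i).mul_left)
        (Continuous.integrable_of_hasCompactSupport
          (by have := (hYc i).continuous; have := hφ.continuous; fun_prop) hφs.mul_left)
        (fun x _ => (hYc i).differentiable one_ne_zero x)
        (fun x _ => hφ.differentiable one_ne_zero x)
      simpa only [hfd] using this
    rw [Finset.sum_congr rfl fun i _ => hibp i, Finset.sum_neg_distrib,
      ← integral_finsetSum _ fun i _ => hinteg i]
    congr 1
    refine integral_congr_ae (Eventually.of_forall fun x => ?_)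
    simp only
    rw [← Finset.sum_mul]
    by_cases hx : x ∈ tsupport φ
    · rw [hdiv _ (ht x hx)]
    · simp [image_eq_zero_of_notMem_tsupport hx]
  have hinteg : ∀ i : Fin m, Integrable fun x =>
      fderiv ℝ (Y i) x e * fderiv ℝ φ x (EuclideanSpace.single i 1) := fun i =>
    Continuous.integrable_of_hasCompactSupport (by have := hYd i; fun_prop) (hgs i).mul_left
  rw [integral_finsetSum _ fun i _ => hinteg i]
  exact hder.unique ((hasDerivAt_const (0 : ℝ) _).congr_of_eventuallyEq hconst)

/-- If `Y` has constant divergence and `∂_e Y · ∇φ` is nonnegative, then `∂_e Y · ∇φ` vanishes. -/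
theorem sum_fderiv_mul_fderiv_eq_zero_of_div_const {m : ℕ}
    {Y : Fin m → EuclideanSpace ℝ (Fin m) → ℝ} {φ : EuclideanSpace ℝ (Fin m) → ℝ}
    {Ω : Set (EuclideanSpace ℝ (Fin m))} {H : ℝ} (hΩ : IsOpen Ω)
    (hY : ∀ i, ContDiffOn ℝ 1 (Y i) Ω)
    (hφ : ContDiff ℝ 1 φ) (hφs : HasCompactSupport φ) (hφΩ : tsupport φ ⊆ Ω)
    (hdiv : ∀ x ∈ Ω, ∑ i, fderiv ℝ (Y i) x (EuclideanSpace.single i 1) = H)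
    (e : EuclideanSpace ℝ (Fin m))
    (hnonneg : ∀ x ∈ Ω,
      0 ≤ ∑ i, fderiv ℝ (Y i) x e * fderiv ℝ φ x (EuclideanSpace.single i 1))
    (x : EuclideanSpace ℝ (Fin m)) :
    ∑ i, fderiv ℝ (Y i) x e * fderiv ℝ φ x (EuclideanSpace.single i 1) = 0 := by
  obtain ⟨T, hT, hφT, hTΩ⟩ := exists_compact_between hφs hΩ hφΩ
  obtain ⟨χ, hχ1, hχ0, -⟩ := exists_contMDiffMap_one_nhds_of_subset_interior
    (n := 1) (modelWithCornersSelf ℝ (EuclideanSpace ℝ (Fin m))) (isClosed_tsupport φ) hφT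
  have hχ : ContDiff ℝ 1 χ := χ.contMDiff.contDiff
  have hχs : tsupport χ ⊆ T :=
    closure_minimal (fun x hx => by_contra fun h => hx (hχ0 x h)) hT.isClosed
  obtain ⟨U, hU, hφU, hUχ⟩ := eventually_nhdsSet_iff_exists.1 hχ1
  set Z : Fin m → EuclideanSpace ℝ (Fin m) → ℝ := fun i x => χ x * Y i x with hZ
  have hZs : ∀ i, HasCompactSupport (Z i) := fun i =>
    HasCompactSupport.mul_right (hT.of_isClosed_subset (isClosed_tsupport _) hχs)
  have hZc : ∀ i, ContDiff ℝ 1 (Z i) := by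
    refine fun i => contDiff_iff_contDiffAt.2 fun x => ?_
    by_cases hx : x ∈ tsupport (Z i)
    swap
    · exact contDiffAt_const.congr_of_eventuallyEq (notMem_tsupport_iff_eventuallyEq.1 hx)
    have hxΩ : x ∈ Ω := hTΩ (hχs (tsupport_mul_subset_left hx))
    exact hχ.contDiffAt.mul ((hY i).contDiffAt (hΩ.mem_nhds hxΩ))
  have hZU : ∀ i, ∀ x ∈ U, fderiv ℝ (Z i) x = fderiv ℝ (Y i) x := by
    intro i x hx
    refine Filter.EventuallyEq.fderiv_eq ?_
    filter_upwards [hU.mem_nhds hx] with y hy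
    simp [hZ, hUχ y hy]
  have hφ0 : ∀ x ∉ tsupport φ, fderiv ℝ φ x = 0 := fun x hx =>
    image_eq_zero_of_notMem_tsupport fun h => hx (tsupport_fderiv_subset ℝ h)
  have hUΩ : tsupport φ ⊆ U ∩ Ω := Set.subset_inter hφU hφΩ
  have hinteg := integral_fderiv_mul_fderiv_eq_zero_of_div_const hZc hZs hφ hφs (hU.inter hΩ) hUΩ
    (fun x hx => by simpa only [hZU _ x hx.1] using hdiv x hx.2) e
  have heq : ∀ x, ∑ i, fderiv ℝ (Z i) x e * fderiv ℝ φ x (EuclideanSpace.single i 1) =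
      ∑ i, fderiv ℝ (Y i) x e * fderiv ℝ φ x (EuclideanSpace.single i 1) := by
    intro x
    by_cases hx : x ∈ tsupport φ
    · simp only [hZU _ x (hφU hx)]
    · simp [hφ0 x hx]
  rw [← heq]
  have hcont : Continuous fun x =>
      ∑ i, fderiv ℝ (Z i) x e * fderiv ℝ φ x (EuclideanSpace.single i 1) := by
    have h1 := hφ.continuous_fderiv one_ne_zero
    have h2 := fun i => (hZc i).continuous_fderiv one_ne_zero
    fun_prop
  have hsupp : HasCompactSupport fun x =>
      ∑ i, fderiv ℝ (Z i) x e * fderiv ℝ φ x (EuclideanSpace.single i 1) := by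
    refine HasCompactSupport.intro hφs fun x hx => ?_
    simp [hφ0 x hx]
  by_contra hne
  refine (hcont.integral_pos_of_hasCompactSupport_nonneg_nonzero (μ := volume) hsupp
    (fun x => ?_) hne).ne' hinteg
  simp only [Pi.zero_apply, heq]
  by_cases hx : x ∈ tsupport φ
  · exact hnonneg x (hφΩ hx)
  · simp [hφ0 x hx]

theorem hasDerivAt_max_zero_sq (t : ℝ) :
    HasDerivAt (fun t : ℝ => max t 0 ^ 2) (2 * max t 0) t := by
  rcases lt_trichotomy t 0 with ht | rfl | ht
  · rw [max_eq_right ht.le, mul_zero]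
    refine (hasDerivAt_const t (0 : ℝ)).congr_of_eventuallyEq ?_
    filter_upwards [gt_mem_nhds ht] with s hs
    simp [max_eq_right (le_of_lt hs)]
  · have hO : (fun t : ℝ => max t 0 ^ 2) =O[𝓝 0] fun t => ‖t - 0‖ ^ 2 := by
      refine Asymptotics.isBigO_of_le _ fun s => ?_
      rw [sub_zero, norm_pow, norm_pow, norm_norm]
      gcongr
      rcases le_total s 0 with h | h <;> simp [h]
    have := (hO.hasFDerivAt (n := 2) one_lt_two).hasDerivAt
    simpa using this
  · rw [max_eq_left ht.le]
    refine (by simpa using hasDerivAt_pow 2 t : HasDerivAt (fun s : ℝ => s ^ 2) (2 * t) t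
      ).congr_of_eventuallyEq ?_
    filter_upwards [lt_mem_nhds ht] with s hs
    simp [max_eq_left (le_of_lt hs)]

theorem contDiff_max_zero_sq : ContDiff ℝ 1 fun t : ℝ => max t 0 ^ 2 := by
  refine contDiff_one_iff_deriv.2 ⟨fun t => (hasDerivAt_max_zero_sq t).differentiableAt, ?_⟩
  rw [funext fun t => (hasDerivAt_max_zero_sq t).deriv]
  fun_prop

/-- Ellipticity of the linearization of `p ↦ p / √(ε² + |p|²)`. -/
theorem mul_norm_sq_le_inner_fderiv_normalized {E G : Type*} [NormedAddCommGroup E]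
    [NormedSpace ℝ E] [NormedAddCommGroup G] [InnerProductSpace ℝ G] {ε : ℝ} (hε : 0 < ε)
    {V : E → G} {x : E} (hV : DifferentiableAt ℝ V x) (e : E) :
    ε ^ 2 / √(ε ^ 2 + ‖V x‖ ^ 2) ^ 3 * ‖fderiv ℝ V x e‖ ^ 2 ≤
      ⟪fderiv ℝ (fun y => (√(ε ^ 2 + ‖V y‖ ^ 2))⁻¹ • V y) x e, fderiv ℝ V x e⟫ := by
  have hpos : 0 < ε ^ 2 + ‖V x‖ ^ 2 := by positivity
  have hs : 0 < √(ε ^ 2 + ‖V x‖ ^ 2) := Real.sqrt_pos.2 hpos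
  have hs2 : √(ε ^ 2 + ‖V x‖ ^ 2) ^ 2 = ε ^ 2 + ‖V x‖ ^ 2 := Real.sq_sqrt hpos.le
  have h1 : HasFDerivAt (fun y => (√(ε ^ 2 + ‖V y‖ ^ 2))⁻¹ • V y) _ x :=
    ((hasDerivAt_inv hs.ne').comp_hasFDerivAt x
      ((hV.hasFDerivAt.norm_sq.const_add (ε ^ 2)).sqrt hpos.ne')).smul hV.hasFDerivAt
  rw [h1.fderiv]
  generalize hsdef : √(ε ^ 2 + ‖V x‖ ^ 2) = s at *
  have hcs : ⟪V x, fderiv ℝ V x e⟫ ^ 2 ≤ ‖V x‖ ^ 2 * ‖fderiv ℝ V x e‖ ^ 2 := by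
    rw [← mul_pow]
    exact sq_le_sq' (abs_le.1 (abs_real_inner_le_norm _ _)).1 (real_inner_le_norm _ _)
  simp [inner_add_left, inner_smul_left, hsdef]
  have h2 : s⁻¹ * ‖fderiv ℝ V x e‖ ^ 2 = (ε ^ 2 / s ^ 3) * ‖fderiv ℝ V x e‖ ^ 2 +
      (‖V x‖ ^ 2 * ‖fderiv ℝ V x e‖ ^ 2) / s ^ 3 := by
    field_simp
    rw [hs2]
    ring
  rw [h2]
  gcongr
  calc _ = ⟪V x, fderiv ℝ V x e⟫ ^ 2 / s ^ 3 := by field_simp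
    _ ≤ _ := by gcongr

/-- Weak maximum principle for a potential `w` of `∂_e V`, where `V / √(ε² + |V|²)` has
constant divergence. -/
theorem le_of_isCompact_superlevel_of_div_const {m : ℕ} (hm : 1 ≤ m)
    {Ω : Set (EuclideanSpace ℝ (Fin m))} (hΩ : IsOpen Ω) {ε : ℝ} (hε : 0 < ε)
    {V : EuclideanSpace ℝ (Fin m) → EuclideanSpace ℝ (Fin m)} (hV : ContDiffOn ℝ 1 V Ω)
    {w : EuclideanSpace ℝ (Fin m) → ℝ} (hw : ContDiffOn ℝ 1 w Ω) {e : EuclideanSpace ℝ (Fin m)}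
    (hVw : ∀ x ∈ Ω, ∀ i, fderiv ℝ V x e i = fderiv ℝ w x (EuclideanSpace.single i 1)) {H k : ℝ}
    (hdiv : ∀ x ∈ Ω, ∑ i, fderiv ℝ (fun y => (√(ε ^ 2 + ‖V y‖ ^ 2))⁻¹ • V y) x
      (EuclideanSpace.single i 1) i = H)
    (hk : IsCompact {x ∈ Ω | k ≤ w x}) : ∀ x ∈ Ω, w x ≤ k := by
  set X : EuclideanSpace ℝ (Fin m) → EuclideanSpace ℝ (Fin m) :=
    fun y => (√(ε ^ 2 + ‖V y‖ ^ 2))⁻¹ • V y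
  have hXc : ContDiffOn ℝ 1 X Ω := by
    have hpos : ∀ y, 0 < ε ^ 2 + ‖V y‖ ^ 2 := fun y => by positivity
    refine ContDiffOn.smul (ContDiffOn.inv ((contDiffOn_const.add (hV.norm_sq ℝ)).sqrt
      fun y _ => (hpos y).ne') fun y _ => (Real.sqrt_pos.2 (hpos y)).ne') hV
  have hXd : ∀ x ∈ Ω, DifferentiableAt ℝ X x := fun x hx =>
    (hXc.contDiffAt (hΩ.mem_nhds hx)).differentiableAt one_ne_zero
  have hcoord : ∀ x ∈ Ω, ∀ i v, fderiv ℝ (fun y => X y i) x v = fderiv ℝ X x v i := by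
    intro x hx i v
    have h := (EuclideanSpace.proj (𝕜 := ℝ) i).hasFDerivAt.comp x (hXd x hx).hasFDerivAt
    exact congrArg (fun L => L v) h.fderiv
  set φ : EuclideanSpace ℝ (Fin m) → ℝ := Ω.indicator fun x => max (w x - k) 0 ^ 2 with hφdef
  have hφs : tsupport φ ⊆ {x ∈ Ω | k ≤ w x} := by
    refine closure_minimal (fun x hx => ?_) hk.isClosed
    by_contra h
    refine hx ?_
    by_cases hxΩ : x ∈ Ω
    · have : w x - k ≤ 0 := by
        by_contra h'
        exact h ⟨hxΩ, by linarith⟩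
      simp [hφdef, hxΩ, this]
    · simp [hφdef, hxΩ]
  have hφcs : HasCompactSupport φ := hk.of_isClosed_subset (isClosed_tsupport _) hφs
  have hφΩ : tsupport φ ⊆ Ω := fun x hx => (hφs hx).1
  have hφeq : ∀ x ∈ Ω, φ =ᶠ[𝓝 x] fun x => max (w x - k) 0 ^ 2 := fun x hx => by
    filter_upwards [hΩ.mem_nhds hx] with y hy
    simp [hφdef, hy]
  have hφc : ContDiff ℝ 1 φ := by
    refine contDiff_iff_contDiffAt.2 fun x => ?_
    by_cases hx : x ∈ tsupport φ
    · refine ContDiffAt.congr_of_eventuallyEq ?_ (hφeq x (hφΩ hx))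
      exact contDiff_max_zero_sq.contDiffAt.comp x
        ((hw.contDiffAt (hΩ.mem_nhds (hφΩ hx))).sub contDiffAt_const)
    · exact contDiffAt_const.congr_of_eventuallyEq (notMem_tsupport_iff_eventuallyEq.1 hx)
  have hφd : ∀ x ∈ Ω, fderiv ℝ φ x = (2 * max (w x - k) 0) • fderiv ℝ w x := fun x hx => by
    rw [(hφeq x hx).fderiv_eq]
    have hwd := (hw.contDiffAt (hΩ.mem_nhds hx)).differentiableAt one_ne_zero
    exact ((hasDerivAt_max_zero_sq (w x - k)).comp_hasFDerivAt x
      (hwd.hasFDerivAt.sub_const k)).fderiv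
  have hsum : ∀ x ∈ Ω, ∑ i, fderiv ℝ (fun y => X y i) x e *
      fderiv ℝ φ x (EuclideanSpace.single i 1) =
      2 * max (w x - k) 0 * ⟪fderiv ℝ X x e, fderiv ℝ V x e⟫ := fun x hx => by
    simp only [hφd x hx, hcoord x hx, PiLp.inner_apply, smul_apply,
      ← hVw x hx, Finset.mul_sum, smul_eq_mul]
    refine Finset.sum_congr rfl fun i _ => ?_
    simp
    ring
  have hell : ∀ x ∈ Ω, ε ^ 2 / √(ε ^ 2 + ‖V x‖ ^ 2) ^ 3 * ‖fderiv ℝ V x e‖ ^ 2 ≤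
      ⟪fderiv ℝ X x e, fderiv ℝ V x e⟫ := fun x hx =>
    mul_norm_sq_le_inner_fderiv_normalized hε
      ((hV.contDiffAt (hΩ.mem_nhds hx)).differentiableAt one_ne_zero) e
  have hzero := sum_fderiv_mul_fderiv_eq_zero_of_div_const hΩ
    (Y := fun i y => X y i) (fun i => (contDiff_piLp_apply 2).comp_contDiffOn hXc) hφc hφcs hφΩ
    (fun x hx => by simpa only [hcoord x hx] using hdiv x hx) e
    (fun x hx => by
      rw [hsum x hx]
      have := (by positivity : (0 : ℝ) ≤ _).trans (hell x hx)
      positivity)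
  have hφd0 : ∀ x, fderiv ℝ φ x = 0 := by
    intro x
    by_cases hx : x ∈ tsupport φ
    swap
    · exact image_eq_zero_of_notMem_tsupport fun h => hx (tsupport_fderiv_subset ℝ h)
    have hxΩ := hφΩ hx
    rw [hφd x hxΩ]
    have h0 := hzero x
    rw [hsum x hxΩ] at h0
    rcases mul_eq_zero.1 h0 with h | h
    · rw [h, zero_smul]
    have hle := h ▸ hell x hxΩ
    have hc : 0 < ε ^ 2 / √(ε ^ 2 + ‖V x‖ ^ 2) ^ 3 := by positivity
    have hV0 : fderiv ℝ V x e = 0 := by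
      by_contra hne
      have : 0 < ‖fderiv ℝ V x e‖ := norm_pos_iff.2 hne
      exact absurd hle (not_le.2 (by positivity))
    have hw0 : fderiv ℝ w x = 0 := by
      refine ContinuousLinearMap.coe_injective
        ((EuclideanSpace.basisFun (Fin m) ℝ).toBasis.ext fun i => ?_)
      simp [← hVw x hxΩ, hV0]
    rw [hw0, smul_zero]
  intro x hx
  by_contra! hlt
  have : Nonempty (Fin m) := ⟨⟨0, hm⟩⟩
  obtain ⟨z, hz⟩ : ∃ z, z ∉ tsupport φ := by
    by_contra! h
    exact noncompact_univ (EuclideanSpace ℝ (Fin m)) (Set.eq_univ_of_forall h ▸ hφcs)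
  have hxz := is_const_of_fderiv_eq_zero (hφc.differentiable one_ne_zero) hφd0 x z
  rw [image_eq_zero_of_notMem_tsupport hz] at hxz
  simp only [hφdef, Set.indicator_of_mem hx] at hxz
  have : 0 < max (w x - k) 0 := lt_max_of_lt_left (by linarith)
  exact absurd hxz (by positivity)

/-- If `w < k` near the frontier of a bounded open set, the superlevel set `{k ≤ w}` is compact. -/
theorem isCompact_superlevel_of_frontier_lt {E : Type*} [PseudoMetricSpace E] [ProperSpace E]
    {Ω : Set E} (hΩ : IsOpen Ω) (hΩb : Bornology.IsBounded Ω) {w : E → ℝ} (hw : ContinuousOn w Ω)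
    {k : ℝ} (hk : ∀ x ∈ frontier Ω, ∀ᶠ y in 𝓝[Ω] x, w y < k) :
    IsCompact {x ∈ Ω | k ≤ w x} := by
  refine Metric.isCompact_of_isClosed_isBounded (isClosed_of_closure_subset fun x hx => ?_)
    (hΩb.subset fun x hx => hx.1)
  have hfreq : ∃ᶠ y in 𝓝[Ω] x, k ≤ w y := by
    rw [mem_closure_iff_frequently] at hx
    rw [frequently_nhdsWithin_iff]
    exact hx.mono fun y hy => ⟨hy.2, hy.1⟩
  by_cases hxΩ : x ∈ Ω
  · refine ⟨hxΩ, not_lt.1 fun hlt => ?_⟩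
    exact hfreq (((hw x hxΩ).eventually_lt_const hlt).mono fun y hy => not_le.2 hy)
  · have hxf : x ∈ frontier Ω := by
      rw [hΩ.frontier_eq]
      exact ⟨closure_mono (fun y hy => hy.1) hx, hxΩ⟩
    exact absurd ((hk x hxf).mono fun y hy => not_le.2 hy) hfreq

/-- **Proposition 4.3** (global gradient bound): if `∂_K F_I = ∂_I f_K` on `Ω` for bounded
`C¹` functions `f_K`, and `u ∈ C²(Ω)`, with `u` and `∇u` extending continuously to `Ω̄`
(the extension of `∇u` being `g`), satisfies `Q_ε u = H₀` in `Ω`, then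
`sup_Ω |∂_K u| ≤ sup_{∂Ω} |∂_K u| + 2 sup_Ω |f_K|`, expressed via arbitrary bounds
`C₁` on `|∂_K u|` over `∂Ω` and `C₂` on `|f_K|` over `Ω`. -/
theorem gradient_bound_of_Qeps_eq_const {m : ℕ} (hm : 1 ≤ m)
    (Ω : Set (EuclideanSpace ℝ (Fin m)))
    (hΩopen : IsOpen Ω) (hΩbdd : Bornology.IsBounded Ω)
    (hΩne : Ω.Nonempty) (hΩconn : IsConnected Ω)
    (ε : ℝ) (hε : 0 < ε)
    (F : EuclideanSpace ℝ (Fin m) → EuclideanSpace ℝ (Fin m))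
    (hF : ContDiffOn ℝ 1 F Ω)
    (f : Fin m → EuclideanSpace ℝ (Fin m) → ℝ)
    (hf : ∀ K, ContDiffOn ℝ 1 (f K) Ω)
    (hfbdd : ∀ K, ∃ M, ∀ x ∈ Ω, |f K x| ≤ M)
    (hcompat : ∀ x ∈ Ω, ∀ I K : Fin m,
      fderiv ℝ (fun y => F y I) x (EuclideanSpace.single K 1) =
        fderiv ℝ (f K) x (EuclideanSpace.single I 1))
    (u : EuclideanSpace ℝ (Fin m) → ℝ)
    (hu : ContDiffOn ℝ 2 u Ω) (huc : ContinuousOn u (closure Ω))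
    (g : EuclideanSpace ℝ (Fin m) → EuclideanSpace ℝ (Fin m))
    (hgc : ContinuousOn g (closure Ω)) (hg : ∀ x ∈ Ω, g x = gradient u x)
    (H₀ : ℝ) (heq : ∀ x ∈ Ω, Qeps ε F u x = H₀)
    (K : Fin m) (C₁ C₂ : ℝ)
    (hC₁ : ∀ x ∈ frontier Ω, |g x K| ≤ C₁)
    (hC₂ : ∀ x ∈ Ω, |f K x| ≤ C₂) :
    ∀ x ∈ Ω, |gradient u x K| ≤ C₁ + 2 * C₂ := by
  have hud : ContDiffOn ℝ 1 (fderiv ℝ u) Ω := hu.fderiv_of_isOpen hΩopen le_rfl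
  have hgrad : ContDiffOn ℝ 1 (gradient u) Ω :=
    (InnerProductSpace.toDual ℝ (EuclideanSpace ℝ (Fin m))).symm.contDiff.comp_contDiffOn hud
  have hgradapp : ∀ x i, gradient u x i = fderiv ℝ u x (EuclideanSpace.single i 1) := fun x i => by
    rw [← InnerProductSpace.toDual_symm_apply (𝕜 := ℝ) (y := fderiv ℝ u x),
      EuclideanSpace.inner_single_right]
    simp [gradient]
  set V := fun y => gradient u y + F y with hVdef
  set w := fun y => gradient u y K + f K y with hwdef
  have hV : ContDiffOn ℝ 1 V Ω := hgrad.add hF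
  have hgradK : ContDiffOn ℝ 1 (fun y => gradient u y K) Ω :=
    (contDiff_piLp_apply 2).comp_contDiffOn hgrad
  have hw : ContDiffOn ℝ 1 w Ω := hgradK.add (hf K)
  have hVw : ∀ x ∈ Ω, ∀ i, fderiv ℝ V x (EuclideanSpace.single K 1) i =
      fderiv ℝ w x (EuclideanSpace.single i 1) := by
    intro x hx i
    have hn := hΩopen.mem_nhds hx
    have hgd := (hgrad.contDiffAt hn).differentiableAt one_ne_zero
    have hFd := (hF.contDiffAt hn).differentiableAt one_ne_zero
    have hfd := ((hf K).contDiffAt hn).differentiableAt one_ne_zero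
    have hgKd := (hgradK.contDiffAt hn).differentiableAt one_ne_zero
    have hudd := (hud.contDiffAt hn).differentiableAt one_ne_zero
    have hFc : fderiv ℝ (fun y => F y i) x (EuclideanSpace.single K 1) =
        fderiv ℝ F x (EuclideanSpace.single K 1) i := by
      have h := (EuclideanSpace.proj (𝕜 := ℝ) i).hasFDerivAt.comp x hFd.hasFDerivAt
      exact congrArg (fun L => L (EuclideanSpace.single K 1)) h.fderiv
    have hgc : ∀ i v, fderiv ℝ (fun y => gradient u y i) x v = fderiv ℝ (gradient u) x v i := by
      intro i v
      have h := (EuclideanSpace.proj (𝕜 := ℝ) i).hasFDerivAt.comp x hgd.hasFDerivAt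
      exact congrArg (fun L => L v) h.fderiv
    have hg2 : ∀ i v, fderiv ℝ (fun y => gradient u y i) x v =
        fderiv ℝ (fderiv ℝ u) x v (EuclideanSpace.single i 1) := by
      intro i v
      simp only [hgradapp]
      have h := hudd.hasFDerivAt.clm_apply (hasFDerivAt_const (EuclideanSpace.single i (1 : ℝ)) x)
      rw [h.fderiv]
      simp
    have hsymm : IsSymmSndFDerivAt ℝ u x := (hu.contDiffAt hn).isSymmSndFDerivAt (by simp)
    rw [hVdef, hwdef, fderiv_fun_add hgd hFd, fderiv_fun_add hgKd hfd]
    simp only [add_apply, PiLp.add_apply]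
    rw [← hgc, ← hFc, hcompat x hx i K, hg2, hg2, hsymm.eq]
  have hbdry : ∀ σ : ℝ, |σ| = 1 → ∀ η > 0, ∀ x ∈ frontier Ω,
      ∀ᶠ y in 𝓝[Ω] x, σ * w y < C₁ + C₂ + η := by
    intro σ hσ η hη x hx
    have hcont : ContinuousWithinAt (fun y => |g y K|) Ω x := by
      have := (hgc x (frontier_subset_closure hx)).mono subset_closure
      exact ((contDiff_piLp_apply (n := 0) (𝕜 := ℝ) 2).continuous.continuousAt.comp_continuousWithinAt
        this).abs
    have hlt : |g x K| < C₁ + η := (hC₁ x hx).trans_lt (lt_add_of_pos_right _ hη)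
    filter_upwards [hcont.eventually_lt_const hlt, self_mem_nhdsWithin] with y hy hyΩ
    rw [hg y hyΩ] at hy
    calc σ * w y ≤ |w y| := (le_abs_self _).trans_eq (by rw [abs_mul, hσ, one_mul])
      _ ≤ |gradient u y K| + |f K y| := abs_add_le _ _
      _ < C₁ + C₂ + η := by linarith [hC₂ y hyΩ]
  have hdiv : ∀ x ∈ Ω, ∑ i, fderiv ℝ (fun y => (√(ε ^ 2 + ‖V y‖ ^ 2))⁻¹ • V y) x
      (EuclideanSpace.single i 1) i = H₀ := heq
  have hupper : ∀ x ∈ Ω, w x ≤ C₁ + C₂ := fun x hx => le_of_forall_pos_le_add fun η hη =>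
    le_of_isCompact_superlevel_of_div_const hm hΩopen hε hV hw hVw hdiv
      (isCompact_superlevel_of_frontier_lt hΩopen hΩbdd hw.continuousOn
        (by simpa using hbdry 1 (by simp) η hη)) x hx
  have hlower : ∀ x ∈ Ω, -w x ≤ C₁ + C₂ := fun x hx => le_of_forall_pos_le_add fun η hη =>
    le_of_isCompact_superlevel_of_div_const (V := fun y => -V y) (w := fun y => -w y)
      (e := EuclideanSpace.single K 1) (H := -H₀) hm hΩopen hε hV.neg hw.neg
      (fun x hx i => by simp [fderiv_fun_neg, hVw x hx i])
      (fun x hx => by simp [fderiv_fun_neg, hdiv x hx])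
      (isCompact_superlevel_of_frontier_lt hΩopen hΩbdd hw.neg.continuousOn
        (by simpa using hbdry (-1) (by simp) η hη)) x hx
  intro x hx
  have hfx := abs_le.1 (hC₂ x hx)
  have h1 := hupper x hx
  have h2 := hlower x hx
  simp only [hwdef] at h1 h2
  exact abs_le.2 ⟨by linarith, by linarith⟩
end

section
/- Proposition 4.4 (boundary gradient estimate on p-convex domains): For every m ≥ 2 and all positive constants a, R, ε₀, M₀, M₁, Φ₁, Φ₂ there exists a constant C > 0 with the following property. Let Ω ⊂ ℝ^m be a p-convex bounded domain with constant a, contained in the ball B_R of radius R centered at the origin. Let F⃗ be a C¹ vector field on an open neighborhood of Ω̄ with |F_I| ≤ M₀ and |∂_J F_I| ≤ M₁ on Ω̄, and let φ be a C² function on an open neighborhood of Ω̄ with all first partials bounded by Φ₁ and all second partials bounded by Φ₂ on Ω̄. If 0 < ε ≤ ε₀, 0 ≤ σ ≤ 1, and u ∈ C²(Ω) ∩ C¹(Ω̄) satisfies Q_ε u = 0 in Ω and u = σφ on ∂Ω, then sup_{∂Ω} |∇u| ≤ C. In particular C is independent of σ and of ε ∈ (0, ε₀]. -/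
open MeasureTheory
open scoped RealInnerProductSpace ENNReal

open Filter Topology

section InnerProduct

variable {E : Type*} [NormedAddCommGroup E] [InnerProductSpace ℝ E]

/-- Second derivative test: the second derivative at a local maximum is nonpositive. -/
theorem IsLocalMax.deriv_deriv_nonpos {f : ℝ → ℝ} {x : ℝ} (h : IsLocalMax f x)
    (hf : ContinuousAt f x) : deriv (deriv f) x ≤ 0 := by
  by_contra! hpos
  have hmin := isLocalMin_of_deriv_deriv_pos hpos h.deriv_eq_zero hf
  have hconst : f =ᶠ[𝓝 x] fun _ => f x := by
    filter_upwards [h, hmin] with y h₁ h₂ using le_antisymm h₁ h₂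
  have h₁ : deriv f =ᶠ[𝓝 x] fun _ => 0 := by
    simpa using hconst.deriv
  have h₂ := h₁.deriv_eq
  simp at h₂
  exact hpos.ne' h₂

/-- At a local maximum the derivative of the gradient is a nonpositive quadratic form. -/
theorem IsLocalMax.inner_fderiv_gradient_nonpos [CompleteSpace E] {f : E → ℝ} {G : E → E}
    {G' : E →L[ℝ] E} {x : E} (h : IsLocalMax f x)
    (hf : ∀ᶠ y in 𝓝 x, HasGradientAt f (G y) y) (hG : HasFDerivAt G G' x) (v : E) :
    ⟪G' v, v⟫ ≤ 0 := by
  have hl (t : ℝ) : HasDerivAt (fun t : ℝ => x + t • v) v t := by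
    simpa using ((hasDerivAt_id t).smul_const v).const_add x
  have hx : x + (0 : ℝ) • v = x := by simp
  have hcl : Tendsto (fun t : ℝ => x + t • v) (𝓝 0) (𝓝 x) := by
    simpa using (hl 0).continuousAt.tendsto
  have h₁ : ∀ᶠ t : ℝ in 𝓝 0, HasDerivAt (fun t : ℝ => f (x + t • v)) ⟪G (x + t • v), v⟫ t := by
    filter_upwards [hcl.eventually hf] with t ht
    simpa [Function.comp_def] using! ht.hasFDerivAt.comp_hasDerivAt t (hl t)
  have h₂ : deriv (fun t : ℝ => f (x + t • v)) =ᶠ[𝓝 0] fun t => ⟪G (x + t • v), v⟫ :=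
    h₁.mono fun t ht => ht.deriv
  have h₃ : HasDerivAt (fun t : ℝ => ⟪G (x + t • v), v⟫) ⟪G' v, v⟫ 0 := by
    have := HasFDerivAt.comp_hasDerivAt (0 : ℝ) (hx.symm ▸ hG :) (hl 0)
    simpa using this.inner ℝ (hasDerivAt_const (0 : ℝ) v)
  have hmax : IsLocalMax (fun t : ℝ => f (x + t • v)) 0 := by
    have : ∀ᶠ t : ℝ in 𝓝 0, f (x + t • v) ≤ f x := hcl.eventually h
    simpa [IsLocalMax, IsMaxFilter] using this
  rw [← h₃.deriv, ← h₂.deriv_eq]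
  exact hmax.deriv_deriv_nonpos h₁.self_of_nhds.continuousAt

/-- For an operator with nonpositive quadratic form, `|V|² tr X ≤ ⟪X V, V⟫`. -/
theorem sq_norm_mul_trace_le_inner [FiniteDimensional ℝ E] (X : E →ₗ[ℝ] E)
    (hX : ∀ v, ⟪X v, v⟫ ≤ 0) (V : E) : ‖V‖ ^ 2 * LinearMap.trace ℝ E X ≤ ⟪X V, V⟫ := by
  classical
  rcases eq_or_ne V 0 with rfl | hV
  · simp
  set e : E := (‖V‖)⁻¹ • V
  have hV' : ‖V‖ ≠ 0 := norm_ne_zero_iff.mpr hV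
  have he : ‖e‖ = 1 := by simp [e, norm_smul, hV']
  have horth : Orthonormal ℝ ((↑) : ({e} : Set E) → E) := by
    rw [orthonormal_subtype_iff_ite]
    simp [he]
  obtain ⟨u, b, hu, hb⟩ := horth.exists_orthonormalBasis_extension
  have heu : e ∈ u := by simpa using hu
  have hbe : b ⟨e, heu⟩ = e := by simp [hb]
  have htr : LinearMap.trace ℝ E X ≤ ⟪X e, e⟫ := by
    rw [LinearMap.trace_eq_sum_inner X b, ← Finset.add_sum_erase _ _ (Finset.mem_univ ⟨e, heu⟩),
      hbe, real_inner_comm]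
    have := Finset.sum_nonpos (s := Finset.univ.erase (⟨e, heu⟩ : u))
      (f := fun i => ⟪b i, X (b i)⟫) (fun i _ => by rw [real_inner_comm]; exact hX _)
    linarith
  have hVe : V = ‖V‖ • e := by simp [e, smul_smul, hV']
  calc ‖V‖ ^ 2 * LinearMap.trace ℝ E X ≤ ‖V‖ ^ 2 * ⟪X e, e⟫ := by gcongr
    _ = ⟪X (‖V‖ • e), ‖V‖ • e⟫ := by
        simp only [map_smul, inner_smul_left, inner_smul_right]; simp; ring
    _ = ⟪X V, V⟫ := by rw [← hVe]

/-- An operator with nonpositive quadratic form has nonpositive trace. -/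
theorem trace_nonpos_of_inner_nonpos [FiniteDimensional ℝ E] (X : E →ₗ[ℝ] E)
    (hX : ∀ v, ⟪X v, v⟫ ≤ 0) : LinearMap.trace ℝ E X ≤ 0 := by
  rw [LinearMap.trace_eq_sum_inner X (stdOrthonormalBasis ℝ E)]
  exact Finset.sum_nonpos fun i _ => by rw [real_inner_comm]; exact hX _

/-- The algebraic core of the barrier argument. If the quadratic form of `A - c e ⊗ e` dominates
the one of `V'`, then the non-divergence form operator with matrix `V'` is bounded above. -/
theorem mul_trace_sub_inner_le [FiniteDimensional ℝ E] {V' A : E →ₗ[ℝ] E} {V e : E} {c C s : ℝ}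
    (he : ‖e‖ = 1) (hs : ‖V‖ ^ 2 ≤ s)
    (hX : ∀ v, ⟪V' v, v⟫ ≤ ⟪A v, v⟫ - c * ⟪e, v⟫ ^ 2)
    (hA : ∀ v, |⟪A v, v⟫| ≤ C * ‖v‖ ^ 2) (hC : 0 ≤ C) :
    s * LinearMap.trace ℝ E V' - ⟪V' V, V⟫ ≤
      s * ((Module.finrank ℝ E + 1) * C) - c * (s - ⟪e, V⟫ ^ 2) := by
  let P : E →ₗ[ℝ] E := c • ((innerₛₗ ℝ e).smulRight e)
  have hP v : P v = (c * ⟪e, v⟫) • e := by simp [P, smul_smul]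
  have hPtr : LinearMap.trace ℝ E P = c := by
    simp [P, LinearMap.trace_smulRight, he]
  have hPi v : ⟪P v, v⟫ = c * ⟪e, v⟫ ^ 2 := by
    rw [hP, inner_smul_left]; simp; ring
  have hXn : ∀ v, ⟪(V' - A + P) v, v⟫ ≤ 0 := fun v => by
    simp only [LinearMap.add_apply, LinearMap.sub_apply, inner_add_left, inner_sub_left, hPi]
    linarith [hX v]
  have h₁ := sq_norm_mul_trace_le_inner _ hXn V
  have h₂ := trace_nonpos_of_inner_nonpos _ hXn
  have h₃ : LinearMap.trace ℝ E A ≤ Module.finrank ℝ E * C := by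
    rw [LinearMap.trace_eq_sum_inner A (stdOrthonormalBasis ℝ E)]
    calc _ ≤ ∑ _i : Fin (Module.finrank ℝ E), C := Finset.sum_le_sum fun i _ => by
          rw [real_inner_comm]
          simpa using (le_abs_self _).trans (hA (stdOrthonormalBasis ℝ E i))
      _ = _ := by simp
  have h₄ := neg_le_of_abs_le (hA V)
  simp only [LinearMap.add_apply, LinearMap.sub_apply, inner_add_left, inner_sub_left, hPi,
    map_add, map_sub, hPtr] at h₁ h₂
  have hs0 : 0 ≤ s := (sq_nonneg _).trans hs
  nlinarith [mul_le_mul_of_nonneg_left h₃ hs0, mul_le_mul_of_nonneg_left hs hC,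
    mul_nonneg (sub_nonneg.2 hs) (neg_nonneg.2 h₂)]

/-- Bessel's inequality for two vectors. -/
theorem inner_sq_add_inner_sq_le {e₁ e₂ : E} (h₁ : ‖e₁‖ = 1) (h₂ : ‖e₂‖ = 1)
    (h : ⟪e₁, e₂⟫ = 0) (V : E) : ⟪e₁, V⟫ ^ 2 + ⟪e₂, V⟫ ^ 2 ≤ ‖V‖ ^ 2 := by
  have := real_inner_self_nonneg (x := V - ⟪e₁, V⟫ • e₁ - ⟪e₂, V⟫ • e₂)
  simp only [inner_sub_left, inner_sub_right, inner_smul_left, inner_smul_right,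
    real_inner_self_eq_norm_sq, h₁, h₂, h, real_inner_comm e₁ e₂, real_inner_comm e₁ V,
    real_inner_comm e₂ V, conj_trivial] at this
  nlinarith [this, real_inner_comm e₁ e₂, real_inner_comm e₁ V, real_inner_comm e₂ V]

end InnerProduct

section Euclidean

variable {m : ℕ}

local notation "𝔼" => EuclideanSpace ℝ (Fin m)

theorem trace_eq_sum_single (X : 𝔼 →ₗ[ℝ] 𝔼) :
    LinearMap.trace ℝ 𝔼 X = ∑ i, X (EuclideanSpace.single i 1) i := by
  rw [LinearMap.trace_eq_sum_inner X (EuclideanSpace.basisFun (Fin m) ℝ)]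
  simp [EuclideanSpace.inner_single_left]

/-- The operator `Qeps` in non-divergence form. -/
theorem Qeps_eq {ε : ℝ} (hε : 0 < ε) {F : 𝔼 → 𝔼} {v : 𝔼 → ℝ} {x : 𝔼} {V' : 𝔼 →L[ℝ] 𝔼}
    (hV : HasFDerivAt (fun y => gradient v y + F y) V' x) :
    Real.sqrt (ε ^ 2 + ‖gradient v x + F x‖ ^ 2) ^ 3 * Qeps ε F v x =
      (ε ^ 2 + ‖gradient v x + F x‖ ^ 2) * LinearMap.trace ℝ 𝔼 V' -
        ⟪V' (gradient v x + F x), gradient v x + F x⟫ := by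
  have hpos : 0 < ε ^ 2 + ‖gradient v x + F x‖ ^ 2 := by positivity
  have hs := ((hasDerivAt_inv (Real.sqrt_pos.2 hpos).ne').comp_hasFDerivAt x
    ((hV.norm_sq.const_add (ε ^ 2)).sqrt hpos.ne')).smul hV
  rw [trace_eq_sum_single, Qeps]
  simp only [Pi.smul_def', Function.comp_def] at hs
  simp only [hs.fderiv]
  set s := Real.sqrt (ε ^ 2 + ‖gradient v x + F x‖ ^ 2) with hsdef
  have hs0 : s ≠ 0 := (Real.sqrt_pos.2 hpos).ne'
  rw [← Real.sq_sqrt hpos.le, ← hsdef]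
  have hin : ⟪V' (gradient v x + F x), gradient v x + F x⟫ =
      ∑ i, ⟪gradient v x + F x, V' (EuclideanSpace.single i 1)⟫ * (gradient v x + F x) i := by
    set w := gradient v x + F x
    have : V' w = ∑ i, w i • V' (EuclideanSpace.single i 1) := by
      conv_lhs => rw [← (EuclideanSpace.basisFun (Fin m) ℝ).sum_repr w]
      simp
    rw [this, sum_inner]
    refine Finset.sum_congr rfl fun i _ => ?_
    rw [inner_smul_left, real_inner_comm]; simp; ring
  rw [hin, Finset.mul_sum, Finset.mul_sum, ← Finset.sum_sub_distrib]
  refine Finset.sum_congr rfl fun i _ => ?_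
  simp [inner_add_left]
  field_simp
  ring

theorem ContDiffAt.eventually_hasGradientAt {f : 𝔼 → ℝ} {x : 𝔼} (hf : ContDiffAt ℝ 2 f x) :
    ∀ᶠ y in 𝓝 x, HasGradientAt f (gradient f y) y := by
  filter_upwards [hf.eventually (by simp)] with y hy
  exact (hy.differentiableAt (by simp)).hasGradientAt

theorem gradient_apply (f : 𝔼 → ℝ) (x : 𝔼) (i : Fin m) :
    gradient f x i = fderiv ℝ f x (EuclideanSpace.single i 1) := by
  rw [← inner_gradient_left, EuclideanSpace.inner_single_right]; simp

theorem ContDiffAt.differentiableAt_gradient {f : 𝔼 → ℝ} {x : 𝔼} (hf : ContDiffAt ℝ 2 f x) :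
    DifferentiableAt ℝ (gradient f) x := by
  refine differentiableAt_euclidean.2 fun i => ?_
  simp only [gradient_apply]
  exact ((hf.fderiv_right (m := 1) (by norm_num)).differentiableAt (by simp)).clm_apply
    (differentiableAt_const _)

theorem fderiv_apply_coord {G : 𝔼 → 𝔼} {x : 𝔼} (hG : DifferentiableAt ℝ G x) (v : 𝔼)
    (i : Fin m) : fderiv ℝ G x v i = fderiv ℝ (fun y => G y i) x v := by
  have : HasFDerivAt (fun y => G y i) ((EuclideanSpace.proj i : 𝔼 →L[ℝ] ℝ) ∘L fderiv ℝ G x) x :=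
    (EuclideanSpace.proj (𝕜 := ℝ) i : 𝔼 →L[ℝ] ℝ).hasFDerivAt.comp x hG.hasFDerivAt
  rw [this.fderiv]; simp

theorem norm_le_card_mul_of_forall_abs_le {w : 𝔼} {M : ℝ} (hw : ∀ i, |w i| ≤ M) :
    ‖w‖ ≤ m * M := by
  conv_lhs => rw [← (EuclideanSpace.basisFun (Fin m) ℝ).sum_repr w]
  refine (norm_sum_le _ _).trans ?_
  calc _ ≤ ∑ _i : Fin m, M := Finset.sum_le_sum fun i _ => by simpa [norm_smul] using hw i
    _ = _ := by simp

theorem abs_inner_le_of_forall_abs_le {A : 𝔼 →L[ℝ] 𝔼} {M : ℝ}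
    (hA : ∀ i j, |A (EuclideanSpace.single j 1) i| ≤ M) (v : 𝔼) :
    |⟪A v, v⟫| ≤ m * (m * M) * ‖v‖ ^ 2 := by
  have hv : ‖A v‖ ≤ m * (m * M) * ‖v‖ := by
    conv_lhs => rw [← (EuclideanSpace.basisFun (Fin m) ℝ).sum_repr v, map_sum]
    refine (norm_sum_le _ _).trans ?_
    calc _ ≤ ∑ _i : Fin m, ‖v‖ * (m * M) := Finset.sum_le_sum fun i _ => by
          simp only [EuclideanSpace.basisFun_repr, map_smul, norm_smul,
            EuclideanSpace.basisFun_apply]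
          gcongr
          · exact PiLp.norm_apply_le v i
          · exact norm_le_card_mul_of_forall_abs_le fun j => hA j i
      _ = _ := by simp; ring
  calc |⟪A v, v⟫| ≤ ‖A v‖ * ‖v‖ := abs_real_inner_le_norm _ _
    _ ≤ m * (m * M) * ‖v‖ * ‖v‖ := by gcongr
    _ = _ := by ring

theorem hasGradientAt_parabola (K a : ℝ) (e₁ e₂ q x : 𝔼) :
    HasGradientAt (fun y => K * (⟪e₂, y - q⟫ - a * ⟪e₁, y - q⟫ ^ 2))
      (K • (e₂ - (2 * a * ⟪e₁, x - q⟫) • e₁)) x := by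
  have h (e : 𝔼) : HasFDerivAt (fun y => ⟪e, y - q⟫) (innerSL ℝ e) x := by
    simpa [Function.comp_def] using!
      (innerSL ℝ e).hasFDerivAt.comp x ((hasFDerivAt_id x).sub_const q)
  rw [hasGradientAt_iff_hasFDerivAt]
  convert! ((h e₂).sub (((h e₁).pow 2).const_mul a)).const_mul K using 1
  ext v
  simp
  left
  ring

theorem hasFDerivAt_gradient_parabola (K a : ℝ) (e₁ e₂ q x : 𝔼) :
    HasFDerivAt (fun x => K • (e₂ - (2 * a * ⟪e₁, x - q⟫) • e₁))
      (-((2 * a * K) • (innerSL ℝ e₁).smulRight e₁)) x := by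
  have h : HasFDerivAt (fun y => ⟪e₁, y - q⟫) (innerSL ℝ e₁) x := by
    simpa [Function.comp_def] using!
      (innerSL ℝ e₁).hasFDerivAt.comp x ((hasFDerivAt_id x).sub_const q)
  convert! (((h.const_mul (2 * a)).smul_const e₁).const_sub e₂).const_smul K using 1
  ext v
  simp
  ring

/-- The slope of the barrier: large enough to absorb the lower order terms. -/
noncomputable def barrierSlope (m : ℕ) (a R ε₀ M₀ M₁ Φ₁ Φ₂ : ℝ) : ℝ :=
  ε₀ + 2 * (m * (Φ₁ + M₀)) +
    (1 + 2 * ((m + 1) * (m * (m * (Φ₂ + M₁)))) * (1 + (2 + 4 * a * R) ^ 2)) / a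

set_option maxHeartbeats 400000 in
/-- The difference between a solution and the barrier `ψ + K (y₂ - a y₁²)` has no interior
local maximum. -/
theorem not_isLocalMax_sub_barrier {a R ε₀ M₀ M₁ Φ₁ Φ₂ ε : ℝ} (ha : 0 < a) (hR : 0 < R)
    (hε₀ : 0 < ε₀) (hM₀ : 0 < M₀) (hM₁ : 0 < M₁) (hΦ₁ : 0 < Φ₁) (hΦ₂ : 0 < Φ₂)
    (hε : 0 < ε) (hεε₀ : ε ≤ ε₀) {F : 𝔼 → 𝔼} {u ψ : 𝔼 → ℝ} {e₁ e₂ q x : 𝔼}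
    (h₁ : ‖e₁‖ = 1) (h₂ : ‖e₂‖ = 1) (h₁₂ : ⟪e₁, e₂⟫ = 0) (hx : ‖x - q‖ ≤ 2 * R)
    (hF : DifferentiableAt ℝ F x) (hF₀ : ∀ i, |F x i| ≤ M₀)
    (hF₁ : ∀ i j, |fderiv ℝ (fun y => F y i) x (EuclideanSpace.single j 1)| ≤ M₁)
    (hψ : ContDiffAt ℝ 2 ψ x) (hψ₁ : ∀ i, |fderiv ℝ ψ x (EuclideanSpace.single i 1)| ≤ Φ₁)
    (hψ₂ : ∀ i j, |fderiv ℝ (fun y => fderiv ℝ ψ y (EuclideanSpace.single i 1)) x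
      (EuclideanSpace.single j 1)| ≤ Φ₂)
    (hu : ContDiffAt ℝ 2 u x) (hQ : Qeps ε F u x = 0) :
    ¬ IsLocalMax (fun y => u y - ψ y - barrierSlope m a R ε₀ M₀ M₁ Φ₁ Φ₂ *
      (⟪e₂, y - q⟫ - a * ⟪e₁, y - q⟫ ^ 2)) x := by
  intro hmax
  set K := barrierSlope m a R ε₀ M₀ M₁ Φ₁ Φ₂ with hK
  set B := m * (Φ₁ + M₀) with hB
  set c := m * (m * (Φ₂ + M₁)) with hc
  set L := 1 + (2 + 4 * a * R) ^ 2 with hL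
  have hB0 : 0 ≤ B := by positivity
  have hc0 : 0 ≤ c := by positivity
  have hL0 : 0 < L := by positivity
  have hKB : 2 * B ≤ K := by
    have : 0 ≤ (1 + 2 * ((m + 1) * c) * L) / a := by positivity
    simp only [hK, barrierSlope]; linarith
  have hKε : ε₀ ≤ K := by
    have : 0 ≤ (1 + 2 * ((m + 1) * c) * L) / a := by positivity
    simp only [hK, barrierSlope]; linarith
  have hKa : 2 * ((m + 1) * c) * L < a * K := by
    have h : a * ((1 + 2 * ((m + 1) * c) * L) / a) = 1 + 2 * ((m + 1) * c) * L := by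
      field_simp
    have : a * K = a * (ε₀ + 2 * B) + (1 + 2 * ((m + 1) * c) * L) := by
      rw [← h, ← mul_add]; rfl
    have : 0 ≤ a * (ε₀ + 2 * B) := by positivity
    linarith
  have hK0 : 0 < K := hε₀.trans_le hKε
  have hgrad : ∀ᶠ y in 𝓝 x, HasGradientAt (fun y => u y - ψ y - K *
      (⟪e₂, y - q⟫ - a * ⟪e₁, y - q⟫ ^ 2))
      (gradient u y - gradient ψ y - K • (e₂ - (2 * a * ⟪e₁, y - q⟫) • e₁)) y := by
    filter_upwards [hu.eventually_hasGradientAt, hψ.eventually_hasGradientAt] with y h h'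
    have := (h.hasFDerivAt.sub h'.hasFDerivAt).sub
      (hasGradientAt_parabola K a e₁ e₂ q y).hasFDerivAt
    rw [hasGradientAt_iff_hasFDerivAt, map_sub, map_sub]
    exact this
  have hG := (hu.differentiableAt_gradient.hasFDerivAt.sub
    hψ.differentiableAt_gradient.hasFDerivAt).sub (hasFDerivAt_gradient_parabola K a e₁ e₂ q x)
  have hquad := hmax.inner_fderiv_gradient_nonpos hgrad hG
  have hzero : gradient u x - gradient ψ x - K • (e₂ - (2 * a * ⟪e₁, x - q⟫) • e₁) = 0 := by
    have := hmax.fderiv_eq_zero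
    rw [hgrad.self_of_nhds.hasFDerivAt.fderiv] at this
    exact (map_eq_zero_iff _ (InnerProductSpace.toDual ℝ 𝔼).injective).1 this
  set b := gradient ψ x + F x with hb
  have hbB : ‖b‖ ≤ B := norm_le_card_mul_of_forall_abs_le fun i => by
    rw [hb, PiLp.add_apply, gradient_apply]
    exact (abs_add_le _ _).trans (add_le_add (hψ₁ i) (hF₀ i))
  set V := gradient u x + F x with hVdef
  have hV : V = K • (e₂ - (2 * a * ⟪e₁, x - q⟫) • e₁) + b := by
    rw [hVdef, hb, ← sub_eq_zero, ← hzero]; abel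
  set A := fderiv ℝ (gradient ψ) x + fderiv ℝ F x with hA
  have hAc (v : 𝔼) : |⟪A v, v⟫| ≤ c * ‖v‖ ^ 2 :=
    abs_inner_le_of_forall_abs_le (fun i j => by
      rw [hA, add_apply, PiLp.add_apply,
        fderiv_apply_coord hψ.differentiableAt_gradient, fderiv_apply_coord hF]
      simp only [gradient_apply]
      exact (abs_add_le _ _).trans (add_le_add (hψ₂ i j) (hF₁ i j))) v
  have hVd := hu.differentiableAt_gradient.hasFDerivAt.add hF.hasFDerivAt
  have hQ' := Qeps_eq hε hVd
  rw [hQ, mul_zero, ← hVdef] at hQ'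
  have ht : |⟪e₁, x - q⟫| ≤ 2 * R := by
    simpa [h₁] using (abs_real_inner_le_norm e₁ (x - q)).trans (by rw [h₁, one_mul]; exact hx)
  have hcore := mul_trace_sub_inner_le (V' := (fderiv ℝ (gradient u) x + fderiv ℝ F x : 𝔼 →L[ℝ] 𝔼))
    (A := (A : 𝔼 →ₗ[ℝ] 𝔼)) (V := V) (c := 2 * a * K) (C := c) (s := ε ^ 2 + ‖V‖ ^ 2) h₁
    (le_add_of_nonneg_left (sq_nonneg _)) (fun v => by
      have := hquad v
      simp [inner_sub_left, inner_add_left, inner_smul_left] at this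
      simp [hA, inner_add_left]
      linarith) hAc hc0
  rw [finrank_euclideanSpace_fin] at hcore
  have hcore' : 0 ≤ (ε ^ 2 + ‖V‖ ^ 2) * ((m + 1) * c) -
      2 * a * K * (ε ^ 2 + ‖V‖ ^ 2 - ⟪e₁, V⟫ ^ 2) := hQ'.trans_le hcore
  have hVn : ‖V‖ ≤ K * (2 + 4 * a * R) := by
    have : ‖e₂ - (2 * a * ⟪e₁, x - q⟫) • e₁‖ ≤ 1 + 2 * a * (2 * R) := by
      refine (norm_sub_le _ _).trans ?_
      rw [h₂, norm_smul, h₁, Real.norm_eq_abs, abs_mul, abs_of_pos (by positivity : 0 < 2 * a), mul_one]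
      gcongr
    rw [hV]
    refine (norm_add_le _ _).trans ?_
    rw [norm_smul, Real.norm_of_nonneg hK0.le]
    have := mul_le_mul_of_nonneg_left this hK0.le
    linarith
  have hs : ε ^ 2 + ‖V‖ ^ 2 ≤ K ^ 2 * L := by
    have h₃ : ε ^ 2 ≤ K ^ 2 := by gcongr; linarith
    have h₄ : ‖V‖ ^ 2 ≤ (K * (2 + 4 * a * R)) ^ 2 := by gcongr
    rw [hL]; linarith
  have hV₂ : K / 2 ≤ ⟪e₂, V⟫ := by
    have h₃ : -B ≤ ⟪e₂, b⟫ := by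
      have := neg_le_of_abs_le (abs_real_inner_le_norm e₂ b)
      rw [h₂] at this; linarith
    rw [hV, inner_add_right, inner_smul_right, inner_sub_right, inner_smul_right,
      real_inner_comm e₁ e₂, h₁₂, real_inner_self_eq_norm_sq, h₂]
    linarith
  have hbes := inner_sq_add_inner_sq_le h₁ h₂ h₁₂ V
  have hV₂' : (K / 2) ^ 2 ≤ ⟪e₂, V⟫ ^ 2 := by gcongr
  have h₃ : K ^ 2 / 4 ≤ ε ^ 2 + ‖V‖ ^ 2 - ⟪e₁, V⟫ ^ 2 := by linarith [sq_nonneg ε]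
  have h₄ : 2 * a * K * (K ^ 2 / 4) ≤ 2 * a * K * (ε ^ 2 + ‖V‖ ^ 2 - ⟪e₁, V⟫ ^ 2) := by gcongr
  have h₅ : (ε ^ 2 + ‖V‖ ^ 2) * ((m + 1) * c) ≤ K ^ 2 * L * ((m + 1) * c) := by gcongr
  have h₆ : K ^ 2 * (2 * ((m + 1) * c) * L) < K ^ 2 * (a * K) := by gcongr
  linarith

/-- The barrier bound for a solution with boundary values `ψ`. -/
theorem sub_le_sub_add_barrierSlope_mul {a R ε₀ M₀ M₁ Φ₁ Φ₂ ε : ℝ} (ha : 0 < a) (hR : 0 < R)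
    (hε₀ : 0 < ε₀) (hM₀ : 0 < M₀) (hM₁ : 0 < M₁) (hΦ₁ : 0 < Φ₁) (hΦ₂ : 0 < Φ₂)
    (hε : 0 < ε) (hεε₀ : ε ≤ ε₀) {Ω : Set 𝔼} (hΩ : IsOpen Ω) (hΩR : Ω ⊆ Metric.ball 0 R)
    {F : 𝔼 → 𝔼} {u ψ : 𝔼 → ℝ} {e₁ e₂ q : 𝔼} (hq : q ∈ frontier Ω)
    (h₁ : ‖e₁‖ = 1) (h₂ : ‖e₂‖ = 1) (h₁₂ : ⟪e₁, e₂⟫ = 0)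
    (hpar : ∀ y ∈ Ω, a * ⟪e₁, y - q⟫ ^ 2 - ⟪e₂, y - q⟫ < 0)
    (hF : ∀ x ∈ Ω, DifferentiableAt ℝ F x) (hF₀ : ∀ x ∈ Ω, ∀ i, |F x i| ≤ M₀)
    (hF₁ : ∀ x ∈ Ω, ∀ i j,
      |fderiv ℝ (fun y => F y i) x (EuclideanSpace.single j 1)| ≤ M₁)
    (hψ : ∀ x ∈ closure Ω, ContDiffAt ℝ 2 ψ x)
    (hψ₁ : ∀ x ∈ Ω, ∀ i, |fderiv ℝ ψ x (EuclideanSpace.single i 1)| ≤ Φ₁)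
    (hψ₂ : ∀ x ∈ Ω, ∀ i j, |fderiv ℝ (fun y => fderiv ℝ ψ y (EuclideanSpace.single i 1)) x
      (EuclideanSpace.single j 1)| ≤ Φ₂)
    (hu : ContDiffOn ℝ 2 u Ω) (huc : ContinuousOn u (closure Ω))
    (hQ : ∀ x ∈ Ω, Qeps ε F u x = 0) (hb : ∀ x ∈ frontier Ω, u x = ψ x) :
    ∀ x ∈ Ω, u x - u q ≤ ψ x - ψ q + barrierSlope m a R ε₀ M₀ M₁ Φ₁ Φ₂ * ‖x - q‖ := by
  set K := barrierSlope m a R ε₀ M₀ M₁ Φ₁ Φ₂ with hK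
  have hK0 : 0 ≤ K := by rw [hK, barrierSlope]; positivity
  have hcpt : IsCompact (closure Ω) := (Metric.isBounded_ball.subset hΩR).isCompact_closure
  have hcR : closure Ω ⊆ Metric.closedBall 0 R :=
    closure_minimal (hΩR.trans Metric.ball_subset_closedBall) Metric.isClosed_closedBall
  have hqc : q ∈ closure Ω := frontier_subset_closure hq
  have hpar' : ∀ y ∈ closure Ω, a * ⟪e₁, y - q⟫ ^ 2 - ⟪e₂, y - q⟫ ≤ 0 :=
    closure_minimal (fun y hy => (hpar y hy).le) (isClosed_le
      (f := fun y => a * ⟪e₁, y - q⟫ ^ 2 - ⟪e₂, y - q⟫) (by fun_prop) continuous_const)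
  have hcont : ContinuousOn (fun y => u y - ψ y - K * (⟪e₂, y - q⟫ - a * ⟪e₁, y - q⟫ ^ 2))
      (closure Ω) :=
    (huc.sub fun y hy => (hψ y hy).continuousAt.continuousWithinAt).sub
      (Continuous.continuousOn (by fun_prop))
  obtain ⟨z, hz, hmax⟩ := hcpt.exists_isMaxOn ⟨q, hqc⟩ hcont
  intro x hx
  have hzx := hmax (subset_closure hx)
  simp only [Set.mem_ofPred_eq] at hzx
  rw [closure_eq_self_union_frontier] at hz
  rcases hz with hz | hz
  · refine absurd (hmax.isLocalMax (mem_of_superset (hΩ.mem_nhds hz) subset_closure)) ?_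
    refine not_isLocalMax_sub_barrier ha hR hε₀ hM₀ hM₁ hΦ₁ hΦ₂ hε hεε₀ h₁ h₂ h₁₂ ?_
      (hF z hz) (hF₀ z hz) (hF₁ z hz) (hψ z (subset_closure hz)) (hψ₁ z hz) (hψ₂ z hz)
      (hu.contDiffAt (hΩ.mem_nhds hz)) (hQ z hz)
    have hz' := mem_closedBall_zero_iff.1 (hcR (subset_closure hz))
    have hq' := mem_closedBall_zero_iff.1 (hcR hqc)
    linarith [norm_sub_le z q]
  · have h₃ := mul_nonneg hK0 (neg_nonneg.2 (hpar' z (frontier_subset_closure hz)))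
    have h₄ : ⟪e₂, x - q⟫ - a * ⟪e₁, x - q⟫ ^ 2 ≤ ‖x - q‖ := by
      have := real_inner_le_norm e₂ (x - q)
      rw [h₂, one_mul] at this
      linarith [mul_nonneg ha.le (sq_nonneg ⟪e₁, x - q⟫)]
    have h₅ := mul_le_mul_of_nonneg_left h₄ hK0
    rw [hb z hz] at hzx
    rw [hb q hq]
    linarith

end Euclidean

section Direction

variable {E : Type*} [NormedAddCommGroup E] [InnerProductSpace ℝ E]

/-- A one-sided growth bound at a boundary point bounds the inward derivatives there, computed
from the continuous extension of the gradient. -/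
theorem inner_le_of_sub_le [CompleteSpace E] {Ω : Set E} (hΩ : IsOpen Ω) {u ψ : E → ℝ} {g : E → E}
    {q v d : E} {K : ℝ} (hq : q ∈ closure Ω) (hu : DifferentiableOn ℝ u Ω)
    (huc : ContinuousOn u (closure Ω)) (hg : ContinuousOn g (closure Ω))
    (hgu : ∀ x ∈ Ω, g x = gradient u x) (hψ : HasGradientAt ψ d q)
    (hle : ∀ x ∈ Ω, u x - u q ≤ ψ x - ψ q + K * ‖x - q‖)
    (hv : ∀ᶠ t : ℝ in 𝓝[>] 0, q + t • v ∈ Ω) : ⟪g q, v⟫ ≤ ⟪d, v⟫ + K * ‖v‖ := by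
  have hl (t : ℝ) : HasDerivAt (fun t : ℝ => q + t • v) v t := by
    simpa using ((hasDerivAt_id t).smul_const v).const_add q
  have hq0 : q + (0 : ℝ) • v = q := by simp
  set s : Set ℝ := {t | q + t • v ∈ Ω}
  have hderiv (t : ℝ) (ht : t ∈ s) :
      HasDerivAt (fun t : ℝ => u (q + t • v)) ⟪g (q + t • v), v⟫ t := by
    have hd := (hu.differentiableAt (hΩ.mem_nhds ht)).hasFDerivAt.comp_hasDerivAt t (hl t)
    rw [hgu _ ht, inner_gradient_left]
    exact hd
  have hcl : Tendsto (fun t : ℝ => q + t • v) (𝓝[s] 0) (𝓝[closure Ω] q) := by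
    refine tendsto_nhdsWithin_iff.2 ⟨?_, ?_⟩
    · simpa using (hl 0).continuousAt.tendsto.mono_left nhdsWithin_le_nhds
    · filter_upwards [self_mem_nhdsWithin] with t ht using subset_closure ht
  have hU : HasDerivWithinAt (fun t : ℝ => u (q + t • v)) ⟪g q, v⟫ (Set.Ici 0) 0 := by
    refine hasDerivWithinAt_Ici_of_tendsto_deriv (s := s)
      (fun t ht => (hderiv t ht).differentiableAt.differentiableWithinAt)
      (by simpa [ContinuousWithinAt] using! (huc q hq).tendsto.comp hcl) hv ?_
    have h₁ : Tendsto (fun t : ℝ => ⟪g (q + t • v), v⟫) (𝓝[>] 0) (𝓝 ⟪g q, v⟫) := by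
      have := ((hg q hq).tendsto.comp hcl).mono_left (nhdsWithin_le_of_mem hv)
      exact this.inner tendsto_const_nhds
    refine h₁.congr' ?_
    filter_upwards [hv] with t ht using (hderiv t ht).deriv.symm
  have hΨ : HasDerivAt (fun t : ℝ => ψ (q + t • v)) ⟪d, v⟫ 0 := by
    have := HasFDerivAt.comp_hasDerivAt (0 : ℝ) (hq0.symm ▸ hψ.hasFDerivAt :) (hl 0)
    simpa [Function.comp_def] using! this
  have hlim₁ := (hasDerivWithinAt_iff_tendsto_slope' (by simp)).1 hU.Ioi_of_Ici
  have hlim₂ := (hasDerivWithinAt_iff_tendsto_slope' (by simp)).1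
    (hΨ.hasDerivWithinAt (s := Set.Ioi 0))
  refine le_of_tendsto_of_tendsto hlim₁ (hlim₂.add_const (K * ‖v‖)) ?_
  filter_upwards [hv, self_mem_nhdsWithin] with t ht ht0
  have ht0 : 0 < t := ht0
  have := hle _ ht
  simp only [add_sub_cancel_left, norm_smul, Real.norm_of_nonneg ht0.le] at this
  simp only [slope_def_field, zero_smul, add_zero, sub_zero]
  rw [div_add' _ _ _ ht0.ne', div_le_div_iff_of_pos_right ht0]
  linarith

/-- A vector whose inner products with an open half-space of directions `v` are bounded by
`C ‖v‖` has norm at most `C`. -/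
theorem norm_le_of_forall_abs_inner_le {w n : E} {C : ℝ} (hC : 0 ≤ C) (hn : n ≠ 0)
    (h : ∀ v, 0 < ⟪v, n⟫ → |⟪w, v⟫| ≤ C * ‖v‖) : ‖w‖ ≤ C := by
  wlog hwn : 0 ≤ ⟪w, n⟫ generalizing w
  · rw [← norm_neg]
    refine this (fun v hv => by simpa using h v hv) ?_
    rw [inner_neg_left]; linarith
  have hsq : ‖w‖ ^ 2 ≤ C * ‖w‖ := by
    have hlim : Tendsto (fun t : ℝ => C * ‖w + t • n‖) (𝓝[>] 0) (𝓝 (C * ‖w‖)) := by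
      have : Continuous fun t : ℝ => C * ‖w + t • n‖ := by fun_prop
      simpa using (this.tendsto 0).mono_left nhdsWithin_le_nhds
    refine ge_of_tendsto hlim ?_
    filter_upwards [self_mem_nhdsWithin] with t ht
    have ht : 0 < t := ht
    have hnn : 0 < ⟪n, n⟫ := real_inner_self_pos.2 hn
    have := (le_abs_self _).trans (h (w + t • n) (by
      rw [inner_add_left, inner_smul_left]; simp only [conj_trivial]; positivity))
    rw [inner_add_right, inner_smul_right, real_inner_self_eq_norm_sq] at this
    linarith [mul_nonneg ht.le hwn]
  rcases (norm_nonneg w).eq_or_lt with h0 | h0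
  · rwa [← h0]
  · nlinarith

/-- Directions in the open half-space of an interior touching ball point into the set. -/
theorem eventually_add_smul_mem_of_ball_subset {Ω : Set E} {x q v : E}
    (hball : Metric.ball x ‖x - q‖ ⊆ Ω) (hv : 0 < ⟪v, x - q⟫) :
    ∀ᶠ t : ℝ in 𝓝[>] 0, q + t • v ∈ Ω := by
  have hlim : Tendsto (fun t : ℝ => t * ‖v‖ ^ 2) (𝓝[>] 0) (𝓝 0) := by
    have : Continuous fun t : ℝ => t * ‖v‖ ^ 2 := by fun_prop
    simpa using (this.tendsto 0).mono_left nhdsWithin_le_nhds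
  filter_upwards [self_mem_nhdsWithin, hlim.eventually_lt_const (by positivity : 0 < 2 * ⟪v, x - q⟫)]
    with t ht htv
  have ht : 0 < t := ht
  refine hball ?_
  rw [mem_ball_iff_norm, ← sq_lt_sq₀ (norm_nonneg _) (norm_nonneg _),
    show q + t • v - x = t • v - (x - q) by abel, norm_sub_sq_real, norm_smul, inner_smul_left,
    Real.norm_of_nonneg ht.le]
  simp only [conj_trivial]
  nlinarith

/-- Boundary points touched by an interior ball are dense in the boundary. -/
theorem exists_ball_subset_frontier_dist_lt [ProperSpace E] {Ω : Set E} (hΩ : IsOpen Ω) {p : E}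
    (hp : p ∈ frontier Ω) {δ : ℝ} (hδ : 0 < δ) :
    ∃ q ∈ frontier Ω, dist q p < δ ∧ ∃ x ∈ Ω, Metric.ball x ‖x - q‖ ⊆ Ω := by
  obtain ⟨x, hx, hxp⟩ := Metric.mem_closure_iff.1 (frontier_subset_closure hp) (δ / 2) (by positivity)
  have hpΩ : p ∈ Ωᶜ := by rw [hΩ.frontier_eq] at hp; exact hp.2
  obtain ⟨q, hq, hxq⟩ := hΩ.isClosed_compl.exists_infDist_eq_dist ⟨p, hpΩ⟩ x
  have hball : Metric.ball x ‖x - q‖ ⊆ Ω := by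
    rw [← dist_eq_norm, ← hxq]
    exact Set.disjoint_compl_right_iff_subset.1 Metric.disjoint_ball_infDist
  have hne : ‖x - q‖ ≠ 0 := by
    rw [norm_ne_zero_iff, sub_ne_zero]; rintro rfl; exact hq hx
  have hqx : dist x q ≤ dist x p := hxq ▸ Metric.infDist_le_dist_of_mem hpΩ
  refine ⟨q, ?_, ?_, x, hx, hball⟩
  · rw [hΩ.frontier_eq]
    refine ⟨closure_mono hball ?_, hq⟩
    rw [closure_ball x hne, mem_closedBall_iff_norm, norm_sub_rev]
  · linarith [dist_triangle_left q p x, dist_comm x p]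

end Direction

/-- Two coordinates of an isometry sending `p` to `0` are the inner products of `y - p` with an
orthonormal pair. -/
theorem exists_orthonormal_pair_of_isometryEquiv {m : ℕ}
    (T : EuclideanSpace ℝ (Fin m) ≃ᵢ EuclideanSpace ℝ (Fin m)) {p : EuclideanSpace ℝ (Fin m)}
    (hT : T p = 0) {i j : Fin m} (hij : i ≠ j) :
    ∃ e₁ e₂ : EuclideanSpace ℝ (Fin m), ‖e₁‖ = 1 ∧ ‖e₂‖ = 1 ∧ ⟪e₁, e₂⟫ = 0 ∧
      ∀ y, T y i = ⟪e₁, y - p⟫ ∧ T y j = ⟪e₂, y - p⟫ := by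
  set L := T.toRealLinearIsometryEquiv with hL
  have hTL (y) : T y = L (y - p) := by
    rw [map_sub, hL, T.toRealLinearIsometryEquiv_apply, T.toRealLinearIsometryEquiv_apply, hT]
    abel
  have hcoord (k : Fin m) (y) : T y k = ⟪L.symm (EuclideanSpace.single k 1), y - p⟫ := by
    rw [← L.inner_map_map, L.apply_symm_apply, ← hTL, EuclideanSpace.inner_single_left]
    simp
  refine ⟨_, _, ?_, ?_, ?_, fun y => ⟨hcoord i y, hcoord j y⟩⟩
  · simp
  · simp
  · rw [L.symm.inner_map_map, EuclideanSpace.inner_single_left]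
    simp [hij]

/-- **Proposition 4.4** (boundary gradient estimate on p-convex domains): for all
`m ≥ 2` and positive constants `a, R, ε₀, M₀, M₁, Φ₁, Φ₂` there is `C > 0` such that
for every p-convex (with constant `a`) bounded domain `Ω ⊆ B_R`, every `C¹` vector
field `F⃗` on a neighborhood of `Ω̄` with `|F_I| ≤ M₀`, `|∂_J F_I| ≤ M₁` on `Ω̄`,
every `C²` function `φ` on a neighborhood of `Ω̄` with first partials bounded by `Φ₁`
and second partials bounded by `Φ₂` on `Ω̄`, every `0 < ε ≤ ε₀`, `0 ≤ σ ≤ 1` and every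
`u ∈ C²(Ω) ∩ C¹(Ω̄)` (with `g` the continuous boundary extension of `∇u`) solving
`Q_ε u = 0` in `Ω` with `u = σφ` on `∂Ω`, one has `sup_{∂Ω} |∇u| ≤ C`. -/
theorem boundary_gradient_estimate {m : ℕ} (hm : 2 ≤ m)
    (a R ε₀ M₀ M₁ Φ₁ Φ₂ : ℝ) (ha : 0 < a) (hR : 0 < R) (hε₀ : 0 < ε₀)
    (hM₀ : 0 < M₀) (hM₁ : 0 < M₁) (hΦ₁ : 0 < Φ₁) (hΦ₂ : 0 < Φ₂) :
    ∃ C > (0 : ℝ),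
      ∀ Ω : Set (EuclideanSpace ℝ (Fin m)),
        IsOpen Ω → Ω.Nonempty → IsConnected Ω → Ω ⊆ Metric.ball 0 R →
        (∀ p ∈ frontier Ω, ∃ T : EuclideanSpace ℝ (Fin m) ≃ᵢ EuclideanSpace ℝ (Fin m),
          T p = 0 ∧ ∀ y ∈ Ω, a * (T y ⟨0, by omega⟩) ^ 2 - T y ⟨1, by omega⟩ < 0) →
      ∀ F : EuclideanSpace ℝ (Fin m) → EuclideanSpace ℝ (Fin m),
        ∀ U : Set (EuclideanSpace ℝ (Fin m)), IsOpen U → closure Ω ⊆ U →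
        ContDiffOn ℝ 1 F U →
        (∀ x ∈ closure Ω, ∀ i, |F x i| ≤ M₀) →
        (∀ x ∈ closure Ω, ∀ i j,
          |fderiv ℝ (fun y => F y i) x (EuclideanSpace.single j 1)| ≤ M₁) →
      ∀ φ : EuclideanSpace ℝ (Fin m) → ℝ,
        ∀ W : Set (EuclideanSpace ℝ (Fin m)), IsOpen W → closure Ω ⊆ W →
        ContDiffOn ℝ 2 φ W →
        (∀ x ∈ closure Ω, ∀ i, |fderiv ℝ φ x (EuclideanSpace.single i 1)| ≤ Φ₁) →
        (∀ x ∈ closure Ω, ∀ i j,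
          |fderiv ℝ (fun y => fderiv ℝ φ y (EuclideanSpace.single i 1)) x
            (EuclideanSpace.single j 1)| ≤ Φ₂) →
      ∀ ε σ : ℝ, 0 < ε → ε ≤ ε₀ → 0 ≤ σ → σ ≤ 1 →
      ∀ u : EuclideanSpace ℝ (Fin m) → ℝ,
        ContDiffOn ℝ 2 u Ω → ContinuousOn u (closure Ω) →
      ∀ g : EuclideanSpace ℝ (Fin m) → EuclideanSpace ℝ (Fin m),
        ContinuousOn g (closure Ω) → (∀ x ∈ Ω, g x = gradient u x) →
        (∀ x ∈ Ω, Qeps ε F u x = 0) →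
        (∀ x ∈ frontier Ω, u x = σ * φ x) →
        ∀ x ∈ frontier Ω, ‖g x‖ ≤ C := by
  refine ⟨m * Φ₁ + barrierSlope m a R ε₀ M₀ M₁ Φ₁ Φ₂, by unfold barrierSlope; positivity, ?_⟩
  intro Ω hΩ _ _ hΩR hconv F U hU hΩU hF hF₀ hF₁ φ W hW hΩW hφ hφ₁ hφ₂ ε σ hε hεε₀ hσ₀ hσ₁ u hu huc
    g hg hgu hQ hb
  set K := barrierSlope m a R ε₀ M₀ M₁ Φ₁ Φ₂ with hK
  have hK0 : 0 ≤ K := by rw [hK, barrierSlope]; positivity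
  have hΩc : Ω ⊆ closure Ω := subset_closure
  have hφd : ∀ x ∈ closure Ω, ContDiffAt ℝ 2 φ x := fun x hx =>
    hφ.contDiffAt (hW.mem_nhds (hΩW hx))
  have hFd : ∀ x ∈ Ω, DifferentiableAt ℝ F x := fun x hx =>
    (hF.contDiffAt (hU.mem_nhds (hΩU (hΩc hx)))).differentiableAt (by simp)
  have hfd (τ : ℝ) (f : EuclideanSpace ℝ (Fin m) → ℝ) (x v) :
      fderiv ℝ (fun y => τ * f y) x v = τ * fderiv ℝ f x v := by
    have := DFunLike.congr_fun (congrFun (fderiv_const_smul_field (𝕜 := ℝ) τ (f := f)) x) v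
    simpa [Pi.smul_def] using! this
  have hmul {τ c C : ℝ} (hτ : |τ| ≤ 1) (hc : |c| ≤ C) : |τ * c| ≤ C := by
    rw [abs_mul]; nlinarith [abs_nonneg c, abs_nonneg τ]
  have hψ₁ {τ : ℝ} (hτ : |τ| ≤ 1) : ∀ x ∈ closure Ω, ∀ i,
      |fderiv ℝ (fun y => τ * φ y) x (EuclideanSpace.single i 1)| ≤ Φ₁ := fun x hx i => by
    rw [hfd]; exact hmul hτ (hφ₁ x hx i)
  have key {τ : ℝ} (hτ : |τ| ≤ 1) {G : EuclideanSpace ℝ (Fin m) → EuclideanSpace ℝ (Fin m)}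
      {v : EuclideanSpace ℝ (Fin m) → ℝ} {h : EuclideanSpace ℝ (Fin m) → EuclideanSpace ℝ (Fin m)}
      (hG : ∀ x ∈ Ω, DifferentiableAt ℝ G x) (hG₀ : ∀ x ∈ Ω, ∀ i, |G x i| ≤ M₀)
      (hG₁ : ∀ x ∈ Ω, ∀ i j,
        |fderiv ℝ (fun y => G y i) x (EuclideanSpace.single j 1)| ≤ M₁)
      (hv : ContDiffOn ℝ 2 v Ω) (hvc : ContinuousOn v (closure Ω))
      (hh : ContinuousOn h (closure Ω)) (hhv : ∀ x ∈ Ω, h x = gradient v x)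
      (hQv : ∀ x ∈ Ω, Qeps ε G v x = 0) (hbv : ∀ x ∈ frontier Ω, v x = τ * φ x)
      {q : EuclideanSpace ℝ (Fin m)} (hq : q ∈ frontier Ω) {w : EuclideanSpace ℝ (Fin m)}
      (hw : ∀ᶠ t : ℝ in 𝓝[>] 0, q + t • w ∈ Ω) : ⟪h q, w⟫ ≤ (m * Φ₁ + K) * ‖w‖ := by
    obtain ⟨T, hT, hpar⟩ := hconv q hq
    obtain ⟨e₁, e₂, h₁, h₂, h₁₂, he⟩ := exists_orthonormal_pair_of_isometryEquiv T hT
      (i := ⟨0, by omega⟩) (j := ⟨1, by omega⟩) (by simp)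
    simp only [fun y => (he y).1, fun y => (he y).2] at hpar
    have hqc := frontier_subset_closure hq
    have hψd : ∀ x ∈ closure Ω, ContDiffAt ℝ 2 (fun y => τ * φ y) x := fun x hx =>
      contDiffAt_const.mul (hφd x hx)
    have hle := sub_le_sub_add_barrierSlope_mul ha hR hε₀ hM₀ hM₁ hΦ₁ hΦ₂ hε hεε₀ hΩ hΩR hq
      h₁ h₂ h₁₂ hpar hG hG₀ hG₁ hψd (fun x hx => hψ₁ hτ x (hΩc hx))
      (fun x hx i j => by
        simp only [hfd]
        exact hmul hτ (hφ₂ x (hΩc hx) i j)) hv hvc hQv hbv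
    refine (inner_le_of_sub_le hΩ hqc (hv.differentiableOn (by simp)) hvc hh hhv
      (hψd q hqc).eventually_hasGradientAt.self_of_nhds hle hw).trans ?_
    rw [add_mul]
    gcongr
    refine (real_inner_le_norm _ _).trans ?_
    gcongr
    exact norm_le_card_mul_of_forall_abs_le fun i => by
      rw [gradient_apply]; exact hψ₁ hτ q hqc i
  have htouch : ∀ q ∈ frontier Ω, ∀ x ∈ Ω, Metric.ball x ‖x - q‖ ⊆ Ω →
      ‖g q‖ ≤ m * Φ₁ + K := by
    intro q hq x hx hball
    have hxq : x - q ≠ 0 := by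
      rw [sub_ne_zero]; rintro rfl
      rw [hΩ.frontier_eq] at hq; exact hq.2 hx
    refine norm_le_of_forall_abs_inner_le (by positivity) hxq fun w hw => abs_le'.2 ?_
    have hw' := eventually_add_smul_mem_of_ball_subset hball hw
    refine ⟨key (τ := σ) (by rwa [abs_of_nonneg hσ₀]) hFd (fun x hx => hF₀ x (hΩc hx))
      (fun x hx => hF₁ x (hΩc hx)) hu huc hg hgu hQ hb hq hw', ?_⟩
    have hgn (x) : gradient (fun y => -u y) x = -gradient u x := by
      simp [gradient, fderiv_fun_neg]
    have := key (τ := -σ) (G := fun y => -F y) (v := fun y => -u y) (h := fun y => -g y)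
      (by rwa [abs_neg, abs_of_nonneg hσ₀]) (fun x hx => (hFd x hx).fun_neg)
      (fun x hx i => by simpa using hF₀ x (hΩc hx) i)
      (fun x hx i j => by simpa using hF₁ x (hΩc hx) i j) hu.neg huc.neg hg.neg
      (fun x hx => by rw [hgn, hgu x hx])
      (fun x hx => by
        have hneg (y) : -gradient u y + -F y = -(gradient u y + F y) := by abel
        have := hQ x hx
        simp only [Qeps] at this ⊢
        simp only [hgn, hneg, norm_neg, smul_neg, fderiv_fun_neg, neg_apply, PiLp.neg_apply,
          Finset.sum_neg_distrib, this, neg_zero])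
      (fun x hx => by rw [hb x hx]; ring) hq hw'
    simpa using this
  intro p hp
  refine le_of_forall_pos_le_add fun η hη => ?_
  obtain ⟨δ, hδ, hδg⟩ := Metric.continuousOn_iff.1 hg p (frontier_subset_closure hp) η hη
  obtain ⟨q, hq, hqp, x, hx, hball⟩ := exists_ball_subset_frontier_dist_lt hΩ hp hδ
  have h₁ := hδg q (frontier_subset_closure hq) hqp
  rw [dist_comm, dist_eq_norm] at h₁
  linarith [htouch q hq x hx hball, norm_sub_norm_le (g p) (g q)]
end

section
/- Lemma 6.1: Let m ≥ 1 and let Ω ⊂ ℝ^m be a bounded domain. Let F⃗ be a continuous vector field on Ω, let u be C¹ on Ω, continuous on Ω̄, and C² on Ω ∖ S(u), and assume F⃗ is C¹ on Ω ∖ S(u). Let H be continuous on Ω ∖ S(u) and locally integrable on Ω, and suppose the classical equation div N(u) = H holds at every point of Ω ∖ S(u). If the (m−1)-dimensional Hausdorff measure of S(u) vanishes, H^{m−1}(S(u)) = 0, then u is a weak solution of div N(u) = H; more precisely, for every smooth function φ with compact support in Ω one has ∫_{Ω∖S(u)} N(u)·∇φ dx + ∫_Ω Hφ dx = 0. -/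
open MeasureTheory
open scoped RealInnerProductSpace ENNReal

/-- The classical divergence `div V = ∑ I ∂_I V_I` of a vector field `V`. -/
noncomputable def diverg {m : ℕ}
    (V : EuclideanSpace ℝ (Fin m) → EuclideanSpace ℝ (Fin m))
    (x : EuclideanSpace ℝ (Fin m)) : ℝ :=
  ∑ i, fderiv ℝ V x (EuclideanSpace.single i 1) i

/-- The singular set `S(u) = {x ∈ Ω : ∇u + F⃗ = 0}`. -/
def pSingSet {m : ℕ} (Ω : Set (EuclideanSpace ℝ (Fin m)))
    (F : EuclideanSpace ℝ (Fin m) → EuclideanSpace ℝ (Fin m))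
    (u : EuclideanSpace ℝ (Fin m) → ℝ) : Set (EuclideanSpace ℝ (Fin m)) :=
  {x ∈ Ω | gradient u x + F x = 0}

/-- The unit normal `N(u) = (∇u + F⃗)/|∇u + F⃗|` (defined off the singular set). -/
noncomputable def pNormal {m : ℕ}
    (F : EuclideanSpace ℝ (Fin m) → EuclideanSpace ℝ (Fin m))
    (u : EuclideanSpace ℝ (Fin m) → ℝ) (x : EuclideanSpace ℝ (Fin m)) :
    EuclideanSpace ℝ (Fin m) :=
  ‖gradient u x + F x‖⁻¹ • (gradient u x + F x)

section

open Metric Set Filter Topology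

theorem exists_finite_ball_cover_of_hausdorffMeasure_eq_zero {X : Type*} [MetricSpace X]
    [MeasurableSpace X] [BorelSpace X] {d : ℝ} (hd : 0 ≤ d) {s : Set X} (hs : IsCompact s)
    (h0 : μH[d] s = 0) {ε : ℝ} (hε : 0 < ε) :
    ∃ (ι : Type) (_ : Fintype ι) (c : ι → X) (r : ι → ℝ),
      (∀ i, c i ∈ s ∧ 0 < r i ∧ r i < ε) ∧ s ⊆ ⋃ i, ball (c i) (r i) ∧ ∑ i, r i ^ d ≤ ε := by
  have hε2 : 0 < ENNReal.ofReal (ε / 2) := by simpa using hε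
  rw [Measure.hausdorffMeasure_apply] at h0
  simp only [ENNReal.iSup_eq_zero] at h0
  have h1 := (h0 _ hε2).trans_lt hε2
  simp only [iInf_lt_iff] at h1
  obtain ⟨t, hst, htd, hsum⟩ := h1
  obtain ⟨δ, hδ, hδsum⟩ := ENNReal.exists_pos_sum_of_countable hε2.ne' ℕ
  have hr : ∀ n, ∃ r : ℝ, 0 < r ∧ r < ε ∧ ediam (t n) < ENNReal.ofReal r ∧
      ENNReal.ofReal (r ^ d) ≤ ediam (t n) ^ d + δ n := by
    intro n
    have hfin : ediam (t n) ≠ ∞ := ((htd n).trans_lt ENNReal.ofReal_lt_top).ne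
    set D := (ediam (t n)).toReal with hD
    have hDD : ENNReal.ofReal D = ediam (t n) := ENNReal.ofReal_toReal hfin
    have hD0 : 0 ≤ D := ENNReal.toReal_nonneg
    have hDε : D < ε := by
      have : D ≤ ε / 2 := ENNReal.toReal_le_of_le_ofReal (by positivity) (htd n)
      linarith
    have hcont : Tendsto (fun r : ℝ => ENNReal.ofReal r ^ d) (𝓝[>] D) (𝓝 (ediam (t n) ^ d)) := by
      rw [← hDD]
      exact ((ENNReal.continuous_rpow_const.comp ENNReal.continuous_ofReal).tendsto D).mono_left
        nhdsWithin_le_nhds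
    have hlt : ediam (t n) ^ d < ediam (t n) ^ d + δ n :=
      ENNReal.lt_add_right (ENNReal.rpow_ne_top_of_nonneg hd hfin) (by exact_mod_cast (hδ n).ne')
    have hgt : ∀ᶠ r in 𝓝[>] D, D < r := self_mem_nhdsWithin
    have hlt' : ∀ᶠ r in 𝓝[>] D, r < ε := mem_nhdsWithin_of_mem_nhds (Iio_mem_nhds hDε)
    obtain ⟨r, hr1, hr2, hr3⟩ := ((hcont.eventually_lt_const hlt).and (hgt.and hlt')).exists
    have hr0 : 0 < r := hD0.trans_lt hr2
    refine ⟨r, hr0, hr3, ?_, ?_⟩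
    · rw [← hDD]
      exact (ENNReal.ofReal_lt_ofReal_iff hr0).2 hr2
    · rw [← ENNReal.ofReal_rpow_of_pos hr0]
      exact hr1.le
  choose r hr0 hrε hrd hrs using hr
  choose c hc using fun n : {n // (t n ∩ s).Nonempty} => n.2
  obtain ⟨I, hI⟩ := hs.elim_finite_subcover (fun n => ball (c n) (r n)) (fun _ => isOpen_ball) (by
    intro x hx
    obtain ⟨n, hn⟩ := mem_iUnion.1 (hst hx)
    refine mem_iUnion.2 ⟨⟨n, x, hn, hx⟩, ?_⟩
    have := (edist_le_ediam_of_mem hn (hc ⟨n, x, hn, hx⟩).1).trans_lt (hrd n)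
    rw [edist_dist] at this
    exact (ENNReal.ofReal_lt_ofReal_iff (hr0 n)).1 this)
  refine ⟨I, inferInstance, fun i => c i, fun i => r i, fun i => ⟨(hc _).2, hr0 _, hrε _⟩, ?_, ?_⟩
  · intro x hx
    obtain ⟨i, hi, hxi⟩ := mem_iUnion₂.1 (hI hx)
    exact mem_iUnion.2 ⟨⟨i, hi⟩, hxi⟩
  · rw [← ENNReal.ofReal_le_ofReal_iff hε.le,
      ENNReal.ofReal_sum_of_nonneg fun i _ => Real.rpow_nonneg (hr0 _).le _]
    calc ∑ i : I, ENNReal.ofReal (r i ^ d)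
        = ∑ i ∈ I, ENNReal.ofReal (r i ^ d) := Finset.sum_coe_sort I fun i => ENNReal.ofReal (r i ^ d)
      _ ≤ ∑ i ∈ I, ((⨆ _ : (t i).Nonempty, ediam (t i) ^ d) + δ i) := by
        refine Finset.sum_le_sum fun i _ => ?_
        rw [ciSup_pos (i.2.mono inter_subset_left)]
        exact hrs i
      _ ≤ ∑' i : {n // (t n ∩ s).Nonempty}, ((⨆ _ : (t i).Nonempty, ediam (t i) ^ d) + δ i) :=
        ENNReal.sum_le_tsum I
      _ ≤ ∑' n, ((⨆ _ : (t n).Nonempty, ediam (t n) ^ d) + δ n) :=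
        ENNReal.tsum_comp_le_tsum_of_injective Subtype.val_injective
          fun n => (⨆ _ : (t n).Nonempty, ediam (t n) ^ d) + (δ n : ℝ≥0∞)
      _ ≤ ENNReal.ofReal (ε / 2) + ENNReal.ofReal (ε / 2) := by
        rw [ENNReal.tsum_add]
        exact add_le_add hsum.le hδsum.le
      _ = ENNReal.ofReal ε := by
        rw [← ENNReal.ofReal_add (by positivity) (by positivity), add_halves]

theorem fderiv_apply_eq_inner_gradient {E : Type*} [NormedAddCommGroup E] [InnerProductSpace ℝ E]
    [CompleteSpace E] (f : E → ℝ) (x v : E) : ⟪v, gradient f x⟫ = fderiv ℝ f x v := by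
  rw [gradient, real_inner_comm, InnerProductSpace.toDual_symm_apply]

theorem integral_fderiv_apply_add_mul_diverg_eq_zero {m : ℕ}
    {G : Set (EuclideanSpace ℝ (Fin m))} (hG : IsOpen G)
    {V : EuclideanSpace ℝ (Fin m) → EuclideanSpace ℝ (Fin m)} (hV : ContDiffOn ℝ 1 V G)
    {ψ : EuclideanSpace ℝ (Fin m) → ℝ} (hψ : ContDiff ℝ 1 ψ) (hc : HasCompactSupport ψ)
    (hs : tsupport ψ ⊆ G) :
    ∫ x, (fderiv ℝ ψ x (V x) + ψ x * diverg V x) = 0 := by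
  set e : Fin m → EuclideanSpace ℝ (Fin m) := fun i => EuclideanSpace.single i 1
  have hVd : ∀ x ∈ tsupport ψ, DifferentiableAt ℝ V x := fun x hx =>
    (hV.contDiffAt (hG.mem_nhds (hs hx))).differentiableAt one_ne_zero
  have hVc : ∀ x ∈ tsupport ψ, ContinuousAt V x := fun x hx => (hVd x hx).continuousAt
  have hV'c : ∀ x ∈ tsupport ψ, ContinuousAt (fderiv ℝ V) x := fun x hx =>
    (hV.contDiffAt (hG.mem_nhds (hs hx))).continuousAt_fderiv one_ne_zero
  have hψ' : Continuous (fderiv ℝ ψ) := hψ.continuous_fderiv one_ne_zero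
  have hfd : ∀ i, ∀ x ∈ tsupport ψ, fderiv ℝ (fun y => V y i) x (e i) = fderiv ℝ V x (e i) i := by
    intro i x hx
    have := ((EuclideanSpace.proj (𝕜 := ℝ) i).hasFDerivAt.comp x (hVd x hx).hasFDerivAt).fderiv
    change fderiv ℝ ((EuclideanSpace.proj i : _ →L[ℝ] ℝ) ∘ V) x (e i) = _
    rw [this]; rfl
  have hmul : ∀ i x, ψ x * fderiv ℝ (fun y => V y i) x (e i) = ψ x * fderiv ℝ V x (e i) i := by
    intro i x
    by_cases hx : x ∈ tsupport ψ
    · rw [hfd i x hx]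
    · simp [image_eq_zero_of_notMem_tsupport hx]
  have key : ∀ (g : EuclideanSpace ℝ (Fin m) → ℝ), tsupport g ⊆ tsupport ψ →
      (∀ x ∈ tsupport ψ, ContinuousAt g x) → Integrable g := by
    intro g hg hgc
    exact (continuous_of_tsupport fun x hx => hgc x (hg hx)).integrable_of_hasCompactSupport
      (hc.mono' ((subset_tsupport g).trans hg))
  have hcoord : ∀ i, ∀ x ∈ tsupport ψ, ContinuousAt (fun y => V y i) x := fun i x hx =>
    (EuclideanSpace.proj (𝕜 := ℝ) i).continuous.continuousAt.comp (hVc x hx)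
  have hcoord' : ∀ i, ∀ x ∈ tsupport ψ, ContinuousAt (fun y => fderiv ℝ V y (e i) i) x :=
    fun i x hx => (EuclideanSpace.proj (𝕜 := ℝ) i).continuous.continuousAt.comp
      ((hV'c x hx).clm_apply continuousAt_const)
  have i1 : ∀ i, Integrable fun x => fderiv ℝ ψ x (e i) * V x i := fun i =>
    key _ ((tsupport_mul_subset_left (f := fun x => fderiv ℝ ψ x (e i))).trans
      (tsupport_fderiv_apply_subset ℝ (e i)))
      fun x hx => (hψ'.clm_apply continuous_const).continuousAt.mul (hcoord i x hx)
  have i2 : ∀ i, Integrable fun x => ψ x * fderiv ℝ V x (e i) i := fun i =>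
    key _ tsupport_mul_subset_left fun x hx => hψ.continuous.continuousAt.mul (hcoord' i x hx)
  have i3 : ∀ i, Integrable fun x => ψ x * V x i := fun i =>
    key _ tsupport_mul_subset_left fun x hx => hψ.continuous.continuousAt.mul (hcoord i x hx)
  have hparts : ∀ i, ∫ x, (fderiv ℝ ψ x (e i) * V x i + ψ x * fderiv ℝ V x (e i) i) = 0 := by
    intro i
    have := integral_mul_fderiv_eq_neg_fderiv_mul_of_integrable (μ := volume) (f := ψ)
      (g := fun x => V x i) (v := e i) (i1 i) (by simpa only [hmul] using i2 i) (i3 i)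
      (fun x _ => hψ.differentiable one_ne_zero x)
      (fun x hx => (EuclideanSpace.proj (𝕜 := ℝ) i).differentiableAt.comp x (hVd x hx))
    simp only [hmul] at this
    rw [integral_add (i1 i) (i2 i), this, add_neg_cancel]
  have hexp : ∀ x, fderiv ℝ ψ x (V x) + ψ x * diverg V x =
      ∑ i, (fderiv ℝ ψ x (e i) * V x i + ψ x * fderiv ℝ V x (e i) i) := by
    intro x
    rw [Finset.sum_add_distrib, ← Finset.mul_sum, diverg]
    congr 1
    have hsum : V x = ∑ i, V x i • e i := by
      simpa [e] using ((EuclideanSpace.basisFun (Fin m) ℝ).sum_repr (V x)).symm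
    conv_lhs => rw [hsum, map_sum]
    simp [mul_comm]
  simp only [hexp]
  rw [integral_finsetSum _ fun i _ => by exact (i1 i).add (i2 i)]
  exact Finset.sum_eq_zero fun i _ => hparts i

theorem exists_smooth_cutoff_integral_norm_fderiv_le {E : Type*} [NormedAddCommGroup E]
    [NormedSpace ℝ E] [FiniteDimensional ℝ E] [MeasurableSpace E] [BorelSpace E]
    (μ : Measure E) [μ.IsAddHaarMeasure] (hd : 1 ≤ Module.finrank ℝ E) :
    ∃ C : ℝ, ∀ K : Set E, IsCompact K → μH[(Module.finrank ℝ E : ℝ) - 1] K = 0 →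
      ∀ ε : ℝ, 0 < ε → ∃ η : E → ℝ, ContDiff ℝ 1 η ∧ (∀ x, 0 ≤ η x ∧ η x ≤ 1) ∧
        (∀ x ∈ K, η =ᶠ[𝓝 x] 0) ∧ (∀ x, η x ≠ 1 → ∃ y ∈ K, dist x y < 2 * ε) ∧
        Integrable (fun x => ‖fderiv ℝ η x‖) μ ∧ ∫ x, ‖fderiv ℝ η x‖ ∂μ ≤ C * ε := by
  let b : ContDiffBump (0 : E) := ⟨1, 2, one_pos, one_lt_two⟩
  have hb : ContDiff ℝ 1 b := b.contDiff
  have hb' : Integrable (fun x => ‖fderiv ℝ b x‖) μ :=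
    ((hb.continuous_fderiv one_ne_zero).integrable_of_hasCompactSupport
      (b.hasCompactSupport.fderiv ℝ)).norm
  refine ⟨∫ x, ‖fderiv ℝ b x‖ ∂μ, ?_⟩
  intro K hK hK0 ε hε
  have hd' : (0 : ℝ) ≤ (Module.finrank ℝ E : ℝ) - 1 := sub_nonneg.2 (by exact_mod_cast hd)
  obtain ⟨ι, _, c, r, hcr, hcov, hsum⟩ :=
    exists_finite_ball_cover_of_hausdorffMeasure_eq_zero hd' hK hK0 hε
  classical
  let g : ι → E → ℝ := fun i x => 1 - b ((r i)⁻¹ • (x - c i))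
  have hr : ∀ i, 0 < r i := fun i => (hcr i).2.1
  have hnorm : ∀ i x, ‖(r i)⁻¹ • (x - c i)‖ = dist x (c i) / r i := fun i x => by
    rw [norm_smul, norm_inv, Real.norm_of_nonneg (hr i).le, dist_eq_norm, div_eq_inv_mul]
  have hg : ∀ i, ContDiff ℝ 1 (g i) := fun i =>
    contDiff_const.sub (hb.comp ((contDiff_id.sub contDiff_const).const_smul _))
  have hg0 : ∀ i x, 0 ≤ g i x := fun i x => sub_nonneg.2 b.le_one
  have hg1 : ∀ i x, g i x ≤ 1 := fun i x => sub_le_self _ b.nonneg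
  have hg' : ∀ i x, ‖fderiv ℝ (g i) x‖ = (r i)⁻¹ * ‖fderiv ℝ b ((r i)⁻¹ • (x - c i))‖ := by
    intro i x
    have h1 : HasFDerivAt (fun x => (r i)⁻¹ • (x - c i)) ((r i)⁻¹ • ContinuousLinearMap.id ℝ E) x :=
      ((hasFDerivAt_id x).sub_const (c i)).const_smul _
    have h2 := ((hb.differentiable one_ne_zero _).hasFDerivAt.comp x h1).const_sub 1
    have h3 : fderiv ℝ (g i) x = _ := h2.fderiv
    rw [h3, norm_neg, ContinuousLinearMap.comp_smul, ContinuousLinearMap.comp_id, norm_smul,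
      norm_inv, Real.norm_of_nonneg (hr i).le]
  have hgint : ∀ i, Integrable (fun x => ‖fderiv ℝ (g i) x‖) μ := fun i => by
    simp only [hg']
    exact ((hb'.comp_smul (inv_ne_zero (hr i).ne')).comp_sub_right (c i)).const_mul _
  have hgval : ∀ i, ∫ x, ‖fderiv ℝ (g i) x‖ ∂μ =
      r i ^ ((Module.finrank ℝ E : ℝ) - 1) * ∫ x, ‖fderiv ℝ b x‖ ∂μ := fun i => by
    simp only [hg']
    rw [integral_const_mul,
      integral_sub_right_eq_self (fun x => ‖fderiv ℝ b ((r i)⁻¹ • x)‖) (c i),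
      Measure.integral_comp_inv_smul_of_nonneg μ (fun x => ‖fderiv ℝ b x‖) (hr i).le,
      Real.rpow_sub_one (hr i).ne', Real.rpow_natCast, smul_eq_mul]
    ring
  have hle : ∀ x, ‖fderiv ℝ (fun x => ∏ i, g i x) x‖ ≤ ∑ i, ‖fderiv ℝ (g i) x‖ := by
    intro x
    rw [fderiv_finsetProd fun i _ => (hg i).differentiable one_ne_zero x]
    refine norm_sum_le_of_le _ fun i _ => ?_
    rw [norm_smul, Real.norm_of_nonneg (Finset.prod_nonneg fun j _ => hg0 j x)]
    exact mul_le_of_le_one_left (norm_nonneg _)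
      (Finset.prod_le_one (fun j _ => hg0 j x) fun j _ => hg1 j x)
  have hη : ContDiff ℝ 1 fun x => ∏ i, g i x := contDiff_prod fun i _ => hg i
  have hsumint : Integrable (fun x => ∑ i, ‖fderiv ℝ (g i) x‖) μ :=
    integrable_finsetSum _ fun i _ => hgint i
  have hint : Integrable (fun x => ‖fderiv ℝ (fun x => ∏ i, g i x) x‖) μ :=
    hsumint.mono' (hη.continuous_fderiv one_ne_zero).norm.aestronglyMeasurable
      (ae_of_all _ fun x => by simpa using hle x)
  refine ⟨fun x => ∏ i, g i x, hη, fun x => ⟨Finset.prod_nonneg fun j _ => hg0 j x,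
    Finset.prod_le_one (fun j _ => hg0 j x) fun j _ => hg1 j x⟩, ?_, ?_, hint, ?_⟩
  · intro x hx
    obtain ⟨i, hi⟩ := mem_iUnion.1 (hcov hx)
    filter_upwards [isOpen_ball.mem_nhds hi] with y hy
    refine Finset.prod_eq_zero (Finset.mem_univ i) ?_
    have : b ((r i)⁻¹ • (y - c i)) = 1 := by
      refine b.one_of_mem_closedBall ?_
      rw [mem_closedBall_zero_iff, hnorm]
      exact (div_le_one (hr i)).2 (mem_ball.1 hy).le
    simp [g, this]
  · intro x hx
    obtain ⟨i, -, hi⟩ := Finset.exists_ne_one_of_prod_ne_one hx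
    refine ⟨c i, (hcr i).1, ?_⟩
    by_contra! hlt
    refine hi ?_
    have : b ((r i)⁻¹ • (x - c i)) = 0 := by
      refine b.zero_of_le_dist ?_
      rw [dist_zero_right, hnorm, le_div_iff₀ (hr i)]
      change 2 * r i ≤ _
      linarith [(hcr i).2.2]
    simp [g, this]
  · calc ∫ x, ‖fderiv ℝ (fun x => ∏ i, g i x) x‖ ∂μ
        ≤ ∫ x, ∑ i, ‖fderiv ℝ (g i) x‖ ∂μ := integral_mono hint hsumint hle
      _ = (∑ i, r i ^ ((Module.finrank ℝ E : ℝ) - 1)) * ∫ x, ‖fderiv ℝ b x‖ ∂μ := by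
        rw [integral_finsetSum _ fun i _ => hgint i, Finset.sum_mul]
        exact Finset.sum_congr rfl fun i _ => hgval i
      _ ≤ (∫ x, ‖fderiv ℝ b x‖ ∂μ) * ε := by
        rw [mul_comm]
        exact mul_le_mul_of_nonneg_left hsum (integral_nonneg fun _ => norm_nonneg _)

theorem addHaar_eq_zero_of_hausdorffMeasure_eq_zero {E : Type*} [NormedAddCommGroup E]
    [NormedSpace ℝ E] [FiniteDimensional ℝ E] [MeasurableSpace E] [BorelSpace E]
    (μ : Measure E) [μ.IsAddHaarMeasure] {d : ℝ} (hd : d ≤ Module.finrank ℝ E) {s : Set E}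
    (hs : μH[d] s = 0) : μ s = 0 :=
  Measure.absolutelyContinuous_isAddHaarMeasure μ μH[(Module.finrank ℝ E : ℝ)]
    (le_antisymm ((Measure.hausdorffMeasure_mono hd s).trans hs.le) zero_le)

theorem integral_fderiv_apply_add_integral_mul_eq_zero_of_null {m : ℕ} (hm : 1 ≤ m)
    {Ω S : Set (EuclideanSpace ℝ (Fin m))} (hG : IsOpen (Ω \ S))
    (hnull : μH[(m : ℝ) - 1] S = 0)
    {V : EuclideanSpace ℝ (Fin m) → EuclideanSpace ℝ (Fin m)} (hV : ContDiffOn ℝ 1 V (Ω \ S))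
    (hV1 : ∀ x, ‖V x‖ ≤ 1) {H : EuclideanSpace ℝ (Fin m) → ℝ}
    (hH : LocallyIntegrableOn H Ω volume) (heq : ∀ x ∈ Ω \ S, diverg V x = H x)
    {φ : EuclideanSpace ℝ (Fin m) → ℝ} (hφ : ContDiff ℝ 1 φ) (hc : HasCompactSupport φ)
    (hs : tsupport φ ⊆ Ω) :
    (∫ x in Ω \ S, fderiv ℝ φ x (V x)) + ∫ x in Ω, H x * φ x = 0 := by
  have hfr : Module.finrank ℝ (EuclideanSpace ℝ (Fin m)) = m := by simp
  have hS0 : volume S = 0 :=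
    addHaar_eq_zero_of_hausdorffMeasure_eq_zero volume (by rw [hfr]; linarith) hnull
  set G := Ω \ S with hGdef
  have hGΩ : (G : Set _) =ᵐ[volume] Ω := sdiff_null_ae_eq_self hS0
  rw [← setIntegral_congr_set hGΩ]
  obtain ⟨C, hcut⟩ := exists_smooth_cutoff_integral_norm_fderiv_le
    (volume : Measure (EuclideanSpace ℝ (Fin m))) (by rw [hfr]; exact hm)
  rw [hfr] at hcut
  have hK : IsCompact (tsupport φ \ G) := hc.isCompact.diff hG
  have hK0 : μH[(m : ℝ) - 1] (tsupport φ \ G) = 0 :=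
    measure_mono_null (fun x hx => by by_contra h; exact hx.2 ⟨hs hx.1, h⟩) hnull
  have hε : ∀ k : ℕ, 0 < 1 / ((k : ℝ) + 1) := fun k => Nat.one_div_pos_of_nat
  choose η hη hη01 hηK hη1 hηint hηle using fun k : ℕ => hcut _ hK hK0 _ (hε k)
  obtain ⟨M, hM⟩ := hc.exists_bound_of_continuous hφ.continuous
  have hM0 : 0 ≤ M := (norm_nonneg _).trans (hM 0)
  have hVle : ∀ (ψ : EuclideanSpace ℝ (Fin m) → ℝ) x, ‖fderiv ℝ ψ x (V x)‖ ≤ ‖fderiv ℝ ψ x‖ :=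
    fun ψ x => (fderiv ℝ ψ x).le_of_opNorm_le_of_le le_rfl (hV1 x) |>.trans_eq (mul_one _)
  have hmeas : ∀ ψ : EuclideanSpace ℝ (Fin m) → ℝ, ContDiff ℝ 1 ψ →
      AEStronglyMeasurable (fun x => fderiv ℝ ψ x (V x)) (volume.restrict G) := fun ψ hψ =>
    ((hψ.continuous_fderiv one_ne_zero).continuousOn.clm_apply
      hV.continuousOn).aestronglyMeasurable hG.measurableSet
  have i1 : IntegrableOn (fun x => fderiv ℝ φ x (V x)) G :=
    (((hφ.continuous_fderiv one_ne_zero).integrable_of_hasCompactSupport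
      (hc.fderiv ℝ)).norm.integrableOn).mono' (hmeas φ hφ) (ae_of_all _ (hVle φ))
  have i2 : IntegrableOn (fun x => H x * φ x) G := by
    refine Integrable.integrableOn ?_
    rw [← integrableOn_iff_integrable_of_support_subset (s := tsupport φ)
      ((Function.support_mul_subset_right _ _).trans (subset_tsupport φ))]
    exact (hH.integrableOn_compact_subset hs hc.isCompact).mul_continuousOn
      hφ.continuous.continuousOn hc.isCompact
  have i3 : ∀ k, IntegrableOn (fun x => φ x * fderiv ℝ (η k) x (V x)) G := fun k =>
    ((hηint k).const_mul M).integrableOn.mono'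
      (hφ.continuous.aestronglyMeasurable.mul (hmeas _ (hη k)))
      (ae_of_all _ fun x => by
        rw [norm_mul]
        exact mul_le_mul (hM x) (hVle _ x) (norm_nonneg _) hM0)
  have i4 : IntegrableOn (fun x => fderiv ℝ φ x (V x) + H x * φ x) G := i1.add i2
  have i5 : ∀ k, IntegrableOn (fun x => η k x * (fderiv ℝ φ x (V x) + H x * φ x)) G := fun k =>
    i4.norm.mono' ((hη k).continuous.aestronglyMeasurable.mul i4.aestronglyMeasurable)
      (ae_of_all _ fun x => by
        rw [norm_mul, Real.norm_of_nonneg (hη01 k x).1]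
        exact mul_le_of_le_one_left (norm_nonneg _) (hη01 k x).2)
  have hsplit : ∀ k, ∫ x in G, η k x * (fderiv ℝ φ x (V x) + H x * φ x) =
      -∫ x in G, φ x * fderiv ℝ (η k) x (V x) := by
    intro k
    have hψs : tsupport (fun x => η k x * φ x) ⊆ tsupport φ := tsupport_mul_subset_right
    have hψG : tsupport (fun x => η k x * φ x) ⊆ G := by
      intro x hx
      by_contra hxG
      refine (notMem_tsupport_iff_eventuallyEq.2 ?_) hx
      filter_upwards [hηK k x ⟨hψs hx, hxG⟩] with y hy
      simp [hy]
    have h0 := integral_fderiv_apply_add_mul_diverg_eq_zero hG hV ((hη k).mul hφ)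
      (hc.mono' ((subset_tsupport _).trans hψs)) hψG
    rw [← setIntegral_eq_integral_of_forall_compl_eq_zero (s := G)] at h0
    · rw [eq_neg_iff_add_eq_zero, ← integral_add (i5 k) (i3 k), ← h0]
      refine setIntegral_congr_fun hG.measurableSet fun x hx => ?_
      have hd : fderiv ℝ (fun x => η k x * φ x) x = η k x • fderiv ℝ φ x + φ x • fderiv ℝ (η k) x :=
        fderiv_fun_mul ((hη k).differentiable one_ne_zero x) (hφ.differentiable one_ne_zero x)
      simp only [hd, heq x hx, add_apply, smul_apply,
        smul_eq_mul]
      ring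
    · intro x hx
      have hx' : x ∉ tsupport (fun x => η k x * φ x) := fun h => hx (hψG h)
      rw [fderiv_of_notMem_tsupport ℝ hx']
      have : η k x * φ x = 0 :=
        image_eq_zero_of_notMem_tsupport (f := fun x => η k x * φ x) hx'
      simp [this]
  have hbound : ∀ k : ℕ, ‖∫ x in G, η k x * (fderiv ℝ φ x (V x) + H x * φ x)‖ ≤
      M * C * (1 / ((k : ℝ) + 1)) := by
    intro k
    rw [hsplit, norm_neg]
    calc ‖∫ x in G, φ x * fderiv ℝ (η k) x (V x)‖
        ≤ ∫ x in G, M * ‖fderiv ℝ (η k) x‖ :=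
          norm_integral_le_of_norm_le ((hηint k).const_mul M).integrableOn
            (ae_of_all _ fun x => by
              rw [norm_mul]
              exact mul_le_mul (hM x) (hVle _ x) (norm_nonneg _) hM0)
      _ ≤ ∫ x, M * ‖fderiv ℝ (η k) x‖ :=
          setIntegral_le_integral ((hηint k).const_mul M)
            (ae_of_all _ fun x => mul_nonneg hM0 (norm_nonneg _))
      _ ≤ M * C * (1 / ((k : ℝ) + 1)) := by
          rw [integral_const_mul, mul_assoc]
          exact mul_le_mul_of_nonneg_left (hηle k) hM0
  have hlim0 : Tendsto (fun k => ∫ x in G, η k x * (fderiv ℝ φ x (V x) + H x * φ x)) atTop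
      (𝓝 0) :=
    squeeze_zero_norm hbound
      (by simpa using tendsto_one_div_add_atTop_nhds_zero_nat.const_mul (M * C))
  have hlim : Tendsto (fun k => ∫ x in G, η k x * (fderiv ℝ φ x (V x) + H x * φ x)) atTop
      (𝓝 (∫ x in G, (fderiv ℝ φ x (V x) + H x * φ x))) := by
    refine tendsto_integral_of_dominated_convergence _ (fun k => (i5 k).aestronglyMeasurable)
      i4.norm (fun k => ae_of_all _ fun x => ?_) ((ae_restrict_mem hG.measurableSet).mono ?_)
    · rw [norm_mul, Real.norm_of_nonneg (hη01 k x).1]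
      exact mul_le_of_le_one_left (norm_nonneg _) (hη01 k x).2
    · intro x hx
      have hxK : x ∈ (tsupport φ \ G)ᶜ := fun h => h.2 hx
      obtain ⟨δ, hδ, hball⟩ := Metric.isOpen_iff.1 hK.isClosed.isOpen_compl x hxK
      have hev : ∀ᶠ k : ℕ in atTop, 1 / ((k : ℝ) + 1) < δ / 2 :=
        tendsto_one_div_add_atTop_nhds_zero_nat.eventually_lt_const (half_pos hδ)
      refine tendsto_const_nhds.congr' ?_
      filter_upwards [hev] with k hk
      have : η k x = 1 := by
        by_contra hne
        obtain ⟨y, hy, hxy⟩ := hη1 k x hne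
        refine hball (mem_ball'.2 ?_) hy
        linarith
      rw [this, one_mul]
  rw [← integral_add i1 i2]
  exact tendsto_nhds_unique hlim hlim0

theorem norm_pNormal_le_one {m : ℕ} (F : EuclideanSpace ℝ (Fin m) → EuclideanSpace ℝ (Fin m))
    (u : EuclideanSpace ℝ (Fin m) → ℝ) (x : EuclideanSpace ℝ (Fin m)) : ‖pNormal F u x‖ ≤ 1 := by
  rw [pNormal, norm_smul, norm_inv, norm_norm]
  exact inv_mul_le_one

theorem isOpen_diff_pSingSet {m : ℕ} {Ω : Set (EuclideanSpace ℝ (Fin m))} (hΩ : IsOpen Ω)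
    {F : EuclideanSpace ℝ (Fin m) → EuclideanSpace ℝ (Fin m)} (hF : ContinuousOn F Ω)
    {u : EuclideanSpace ℝ (Fin m) → ℝ} (hu : ContDiffOn ℝ 1 u Ω) :
    IsOpen (Ω \ pSingSet Ω F u) := by
  have hgrad : ContinuousOn (gradient u) Ω :=
    (InnerProductSpace.toDual ℝ _).symm.continuous.comp_continuousOn
      (hu.continuousOn_fderiv_of_isOpen hΩ le_rfl)
  have : Ω \ pSingSet Ω F u = Ω ∩ (fun x => gradient u x + F x) ⁻¹' {0}ᶜ := by
    ext x
    simp [pSingSet]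
  rw [this]
  exact (hgrad.add hF).isOpen_inter_preimage hΩ isOpen_compl_singleton

theorem contDiffOn_pNormal {m : ℕ} {G : Set (EuclideanSpace ℝ (Fin m))} (hG : IsOpen G)
    {F : EuclideanSpace ℝ (Fin m) → EuclideanSpace ℝ (Fin m)} (hF : ContDiffOn ℝ 1 F G)
    {u : EuclideanSpace ℝ (Fin m) → ℝ} (hu : ContDiffOn ℝ 2 u G)
    (h0 : ∀ x ∈ G, gradient u x + F x ≠ 0) : ContDiffOn ℝ 1 (pNormal F u) G := by
  have hgrad : ContDiffOn ℝ 1 (gradient u) G :=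
    (InnerProductSpace.toDual ℝ _).symm.contDiff.comp_contDiffOn
      (hu.fderiv_of_isOpen hG (by norm_num))
  have hsum : ContDiffOn ℝ 1 (fun x => gradient u x + F x) G := hgrad.add hF
  exact ((hsum.norm ℝ h0).inv fun x hx => norm_ne_zero_iff.2 (h0 x hx)).smul hsum

end

/-- **Lemma 6.1**: if `u ∈ C¹(Ω) ∩ C²(Ω∖S(u)) ∩ C⁰(Ω̄)` solves `div N(u) = H`
classically on `Ω ∖ S(u)` with `F⃗ ∈ C¹(Ω∖S(u))` continuous on `Ω`, `H` continuous on
`Ω∖S(u)` and locally integrable on `Ω`, and if `H^{m−1}(S(u)) = 0`, then `u` is a weak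
solution: `∫_{Ω∖S(u)} N(u)·∇φ + ∫_Ω Hφ = 0` for every smooth `φ` compactly supported
in `Ω`. -/
theorem weak_solution_of_null_singular_set {m : ℕ} (hm : 1 ≤ m)
    (Ω : Set (EuclideanSpace ℝ (Fin m)))
    (hΩopen : IsOpen Ω) (hΩbdd : Bornology.IsBounded Ω)
    (hΩne : Ω.Nonempty) (hΩconn : IsConnected Ω)
    (F : EuclideanSpace ℝ (Fin m) → EuclideanSpace ℝ (Fin m))
    (hFc : ContinuousOn F Ω)
    (u : EuclideanSpace ℝ (Fin m) → ℝ)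
    (hu1 : ContDiffOn ℝ 1 u Ω)
    (hu2 : ContDiffOn ℝ 2 u (Ω \ pSingSet Ω F u))
    (huc : ContinuousOn u (closure Ω))
    (hF1 : ContDiffOn ℝ 1 F (Ω \ pSingSet Ω F u))
    (H : EuclideanSpace ℝ (Fin m) → ℝ)
    (hHc : ContinuousOn H (Ω \ pSingSet Ω F u))
    (hHloc : LocallyIntegrableOn H Ω volume)
    (heq : ∀ x ∈ Ω \ pSingSet Ω F u, diverg (pNormal F u) x = H x)
    (hnull : μH[(m : ℝ) - 1] (pSingSet Ω F u) = 0) :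
    ∀ φ : EuclideanSpace ℝ (Fin m) → ℝ, ContDiff ℝ (⊤ : ℕ∞) φ →
      HasCompactSupport φ → tsupport φ ⊆ Ω →
      (∫ x in Ω \ pSingSet Ω F u, ⟪pNormal F u x, gradient φ x⟫) +
        (∫ x in Ω, H x * φ x) = 0 := by
  intro φ hφ hc hs
  have hG := isOpen_diff_pSingSet hΩopen hFc hu1
  simp only [fderiv_apply_eq_inner_gradient]
  exact integral_fderiv_apply_add_integral_mul_eq_zero_of_null hm hG hnull
    (contDiffOn_pNormal hG hF1 hu2 fun x hx h => hx.2 ⟨hx.1, h⟩) (norm_pNormal_le_one F u)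
    hHloc heq (hφ.of_le (by exact_mod_cast le_top)) hc hs
end

section
/- Theorem 8.2 (comparison principle for the elliptic approximation): Let m ≥ 1, let Ω ⊂ ℝ^m be a bounded domain, let ε > 0, and let F⃗ : Ω → ℝ^m be a measurable vector field. Let u, v be C¹ on Ω and extend continuously to Ω̄. Suppose Q_ε u − Q_ε v ≥ 0 weakly, i.e. ∫_Ω (N_ε(u) − N_ε(v))·∇φ dx ≤ 0 for every nonnegative C¹ function φ with compact support in Ω, and suppose u ≤ v on ∂Ω (for the continuous extensions). Then u(x) ≤ v(x) for every x ∈ Ω. -/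
open MeasureTheory
open scoped RealInnerProductSpace ENNReal

/-- The regularized unit normal `N_ε(w) = (∇w + F⃗)/√(ε² + |∇w + F⃗|²)`. -/
noncomputable def regNormal {m : ℕ} (ε : ℝ)
    (F : EuclideanSpace ℝ (Fin m) → EuclideanSpace ℝ (Fin m))
    (w : EuclideanSpace ℝ (Fin m) → ℝ) (x : EuclideanSpace ℝ (Fin m)) :
    EuclideanSpace ℝ (Fin m) :=
  (Real.sqrt (ε ^ 2 + ‖gradient w x + F x‖ ^ 2))⁻¹ • (gradient w x + F x)

lemma regularized_norm_pos {E : Type*} [NormedAddCommGroup E] {ε : ℝ} (hε : 0 < ε) (a : E) :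
    0 < √(ε ^ 2 + ‖a‖ ^ 2) := by
  positivity

section RegularizedNormalization

variable {E : Type*} [NormedAddCommGroup E] [InnerProductSpace ℝ E] {ε : ℝ}

lemma norm_regularized_le_one (hε : 0 < ε) (a : E) :
    ‖(√(ε ^ 2 + ‖a‖ ^ 2))⁻¹ • a‖ ≤ 1 := by
  have hs := regularized_norm_pos hε a
  rw [norm_smul, norm_inv, Real.norm_of_nonneg hs.le, inv_mul_le_one₀ hs]
  exact Real.le_sqrt_of_sq_le (by nlinarith)

lemma regularized_inner_lt (hε : 0 < ε) {a b : E} (hab : a ≠ b) :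
    ε ^ 2 + ⟪a, b⟫ < √(ε ^ 2 + ‖a‖ ^ 2) * √(ε ^ 2 + ‖b‖ ^ 2) := by
  rw [← Real.sqrt_mul (by positivity)]
  apply Real.lt_sqrt_of_sq_lt
  have h1 : 0 < ‖a - b‖ ^ 2 := by
    have := norm_pos_iff.2 (sub_ne_zero.2 hab)
    positivity
  rw [norm_sub_sq_real] at h1
  have h2 : ⟪a, b⟫ ^ 2 ≤ ‖a‖ ^ 2 * ‖b‖ ^ 2 := by
    rw [← mul_pow]
    exact sq_le_sq.2 (by rw [abs_of_nonneg (by positivity : 0 ≤ ‖a‖ * ‖b‖)]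
                         exact abs_real_inner_le_norm a b)
  nlinarith [mul_pos (pow_pos hε 2) h1]

/-- The map `a ↦ a / √(ε² + |a|²)` is strictly monotone. -/
lemma inner_regularized_sub_pos (hε : 0 < ε) {a b : E} (hab : a ≠ b) :
    0 < ⟪(√(ε ^ 2 + ‖a‖ ^ 2))⁻¹ • a - (√(ε ^ 2 + ‖b‖ ^ 2))⁻¹ • b, a - b⟫ := by
  have hs := regularized_norm_pos hε a
  have ht := regularized_norm_pos hε b
  have hst := regularized_inner_lt hε hab
  have hs2 := Real.sq_sqrt (by positivity : 0 ≤ ε ^ 2 + ‖a‖ ^ 2)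
  have ht2 := Real.sq_sqrt (by positivity : 0 ≤ ε ^ 2 + ‖b‖ ^ 2)
  set s := √(ε ^ 2 + ‖a‖ ^ 2)
  set t := √(ε ^ 2 + ‖b‖ ^ 2)
  have key : ⟪s⁻¹ • a - t⁻¹ • b, a - b⟫
      = (s⁻¹ + t⁻¹) * (s * t - (ε ^ 2 + ⟪a, b⟫)) := by
    simp only [inner_sub_left, inner_sub_right, real_inner_smul_left,
      real_inner_self_eq_norm_sq, real_inner_comm a b]
    rw [show ‖a‖ ^ 2 = s ^ 2 - ε ^ 2 by linarith, show ‖b‖ ^ 2 = t ^ 2 - ε ^ 2 by linarith]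
    field_simp
    ring
  rw [key]
  exact mul_pos (by positivity) (by linarith)

end RegularizedNormalization

section Gradient

variable {E : Type*} [NormedAddCommGroup E] [InnerProductSpace ℝ E] [CompleteSpace E]

lemma ContDiff.continuous_gradient {f : E → ℝ} (hf : ContDiff ℝ 1 f) :
    Continuous (gradient f) :=
  (InnerProductSpace.toDual ℝ E).symm.continuous.comp (hf.continuous_fderiv one_ne_zero)

lemma measurable_gradient [MeasurableSpace E] [BorelSpace E] [SecondCountableTopology E]
    (f : E → ℝ) : Measurable (gradient f) :=
  (InnerProductSpace.toDual ℝ E).symm.continuous.measurable.comp (measurable_fderiv ℝ f)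

lemma HasCompactSupport.gradient {f : E → ℝ} (hf : HasCompactSupport f) :
    HasCompactSupport (gradient f) :=
  (hf.fderiv ℝ).comp_left (g := (InnerProductSpace.toDual ℝ E).symm) (map_zero _)

lemma gradient_comp_sub {η : ℝ → ℝ} {u v : E → ℝ} {x : E}
    (hη : DifferentiableAt ℝ η (u x - v x)) (hu : DifferentiableAt ℝ u x)
    (hv : DifferentiableAt ℝ v x) :
    gradient (fun y => η (u y - v y)) x
      = deriv η (u x - v x) • (gradient u x - gradient v x) := by
  have h := hη.hasDerivAt.comp_hasFDerivAt x (hu.hasFDerivAt.sub hv.hasFDerivAt)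
  have h' : fderiv ℝ (fun y => η (u y - v y)) x
      = deriv η (u x - v x) • (fderiv ℝ u x - fderiv ℝ v x) := h.fderiv
  simp [_root_.gradient, h', map_smul, map_sub]

end Gradient

section RegNormal

variable {m : ℕ} {ε : ℝ} {F : EuclideanSpace ℝ (Fin m) → EuclideanSpace ℝ (Fin m)}

lemma measurable_regNormal (hF : Measurable F) (w : EuclideanSpace ℝ (Fin m) → ℝ) :
    Measurable (regNormal ε F w) := by
  have h : Measurable fun x => gradient w x + F x := (measurable_gradient w).add hF
  exact ((h.norm.pow_const 2).const_add _).sqrt.inv.smul h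

lemma norm_regNormal_le_one (hε : 0 < ε) (w : EuclideanSpace ℝ (Fin m) → ℝ)
    (x : EuclideanSpace ℝ (Fin m)) : ‖regNormal ε F w x‖ ≤ 1 :=
  norm_regularized_le_one hε _

lemma inner_regNormal_sub_pos (hε : 0 < ε) {u v : EuclideanSpace ℝ (Fin m) → ℝ}
    {x : EuclideanSpace ℝ (Fin m)} (h : gradient u x ≠ gradient v x) :
    0 < ⟪regNormal ε F u x - regNormal ε F v x, gradient u x - gradient v x⟫ := by
  have := inner_regularized_sub_pos hε
    (a := gradient u x + F x) (b := gradient v x + F x) (by simpa using h)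
  rwa [add_sub_add_right_eq_sub] at this

lemma integrable_inner_regNormal_sub (hε : 0 < ε) (hF : Measurable F)
    (u v : EuclideanSpace ℝ (Fin m) → ℝ) {φ : EuclideanSpace ℝ (Fin m) → ℝ}
    (hφ : ContDiff ℝ 1 φ) (hφc : HasCompactSupport φ) :
    Integrable fun x => ⟪regNormal ε F u x - regNormal ε F v x, gradient φ x⟫ := by
  have hg : Integrable (gradient φ) :=
    hφ.continuous_gradient.integrable_of_hasCompactSupport hφc.gradient
  refine (hg.norm.const_mul 2).mono'
    (((measurable_regNormal hF u).sub (measurable_regNormal hF v)).inner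
      (measurable_gradient φ)).aestronglyMeasurable (.of_forall fun x => ?_)
  refine (norm_inner_le_norm _ _).trans ?_
  gcongr
  have h1 := norm_regNormal_le_one (F := F) hε u x
  have h2 := norm_regNormal_le_one (F := F) hε v x
  linarith [norm_sub_le (regNormal ε F u x) (regNormal ε F v x)]

end RegNormal

/-- If `w ≤ 0` on the boundary of a bounded open set, then composing `w` with a function vanishing
on `(-∞, δ]` and extending by zero gives a function compactly supported in that set. -/
lemma indicator_comp_compactSupport {E : Type*} [PseudoMetricSpace E] [ProperSpace E]
    {Ω : Set E} (hΩ : Bornology.IsBounded Ω) (hΩo : IsOpen Ω)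
    {w : E → ℝ} (hw : ContinuousOn w (closure Ω)) (hb : ∀ x ∈ frontier Ω, w x ≤ 0)
    {δ : ℝ} (hδ : 0 < δ) {η : ℝ → ℝ} (hη0 : ∀ t ≤ δ, η t = 0) :
    HasCompactSupport (Ω.indicator fun x => η (w x)) ∧
      tsupport (Ω.indicator fun x => η (w x)) ⊆ Ω := by
  set K := closure Ω ∩ w ⁻¹' Set.Ici δ
  have hKc : IsClosed K := hw.preimage_isClosed_of_isClosed isClosed_closure isClosed_Ici
  have hK : IsCompact K := hΩ.isCompact_closure.of_isClosed_subset hKc Set.inter_subset_left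
  have hKΩ : K ⊆ Ω := by
    rintro x ⟨hx, hxδ⟩
    by_contra hxΩ
    have h1 := hb x (by rw [hΩo.frontier_eq]; exact ⟨hx, hxΩ⟩)
    have h2 : δ ≤ w x := hxδ
    linarith
  have hsupp : Function.support (Ω.indicator fun x => η (w x)) ⊆ K := by
    intro x hx
    rw [Function.mem_support, Set.indicator_apply_ne_zero] at hx
    refine ⟨subset_closure hx.1, ?_⟩
    by_contra h
    exact hx.2 (hη0 _ (not_le.1 h).le)
  have hts := closure_minimal hsupp hKc
  exact ⟨hK.of_isClosed_subset (isClosed_tsupport _) hts, hts.trans hKΩ⟩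

lemma contDiff_indicator_of_tsupport_subset {E : Type*} [NormedAddCommGroup E] [NormedSpace ℝ E]
    {Ω : Set E} (hΩo : IsOpen Ω) {f : E → ℝ}
    (hf : ContDiffOn ℝ 1 f Ω) (hs : tsupport (Ω.indicator f) ⊆ Ω) :
    ContDiff ℝ 1 (Ω.indicator f) := by
  refine contDiff_iff_contDiffAt.2 fun x => ?_
  by_cases hx : x ∈ tsupport (Ω.indicator f)
  swap
  · exact contDiffAt_const.congr_of_eventuallyEq (notMem_tsupport_iff_eventuallyEq.1 hx)
  have hxo := hΩo.mem_nhds (hs hx)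
  exact (hf.contDiffAt hxo).congr_of_eventuallyEq
    (Filter.eventuallyEq_of_mem hxo fun y hy => Set.indicator_of_mem hy f)

lemma eq_zero_of_gradient_eq_zero {E : Type*} [NormedAddCommGroup E] [InnerProductSpace ℝ E]
    [CompleteSpace E] [Nontrivial E] {φ : E → ℝ} (hφ : Differentiable ℝ φ)
    (hc : HasCompactSupport φ) (h : ∀ x, gradient φ x = 0) : φ = 0 := by
  have hf : ∀ x, fderiv ℝ φ x = 0 := fun x => by rw [← toDual_gradient, h x, map_zero]
  obtain ⟨y, hy⟩ : ∃ y, φ y = 0 := by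
    by_contra! hne
    have : tsupport φ = Set.univ := by
      rw [tsupport, Function.support_eq_univ hne, closure_univ]
    exact NormedSpace.unbounded_univ ℝ E (this ▸ hc.isCompact.isBounded)
  funext x
  rw [is_const_of_fderiv_eq_zero hφ hf x y, hy, Pi.zero_apply]

/-- **Theorem 8.2** (comparison principle for the elliptic approximation): let `u, v` be
`C¹` on the bounded domain `Ω` and continuous on `Ω̄`.  If `Q_ε u − Q_ε v ≥ 0` weakly,
i.e. `∫_Ω (N_ε(u) − N_ε(v))·∇φ ≤ 0` for every nonnegative `C¹` function `φ` with
compact support in `Ω`, and `u ≤ v` on `∂Ω`, then `u ≤ v` in `Ω`. -/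
theorem comparison_principle_elliptic {m : ℕ} (hm : 1 ≤ m)
    (Ω : Set (EuclideanSpace ℝ (Fin m)))
    (hΩopen : IsOpen Ω) (hΩbdd : Bornology.IsBounded Ω)
    (hΩne : Ω.Nonempty) (hΩconn : IsConnected Ω)
    (ε : ℝ) (hε : 0 < ε)
    (F : EuclideanSpace ℝ (Fin m) → EuclideanSpace ℝ (Fin m))
    (hFmeas : Measurable F)
    (u v : EuclideanSpace ℝ (Fin m) → ℝ)
    (hu1 : ContDiffOn ℝ 1 u Ω) (huc : ContinuousOn u (closure Ω))
    (hv1 : ContDiffOn ℝ 1 v Ω) (hvc : ContinuousOn v (closure Ω))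
    (hweak : ∀ φ : EuclideanSpace ℝ (Fin m) → ℝ, ContDiff ℝ 1 φ →
      HasCompactSupport φ → tsupport φ ⊆ Ω → (∀ x, 0 ≤ φ x) →
      (∫ x in Ω, ⟪regNormal ε F u x - regNormal ε F v x, gradient φ x⟫) ≤ 0)
    (hbdry : ∀ x ∈ frontier Ω, u x ≤ v x) :
    ∀ x ∈ Ω, u x ≤ v x := by
  by_contra! hcon
  obtain ⟨x₀, hx₀, hlt⟩ := hcon
  have : Nonempty (Fin m) := ⟨⟨0, hm⟩⟩
  set δ := (u x₀ - v x₀) / 2 with hδdef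
  have hδ : 0 < δ := by linarith
  set η : ℝ → ℝ := fun t => Real.smoothTransition (t - δ)
  have hηc : ContDiff ℝ 1 η := Real.smoothTransition.contDiff.comp (contDiff_id.sub contDiff_const)
  have hηm : Monotone η := fun s t hst => Real.smoothTransition.monotone (by linarith)
  have hη0 : ∀ t ≤ δ, η t = 0 := fun t ht => Real.smoothTransition.zero_of_nonpos (by linarith)
  set φ := Ω.indicator fun x => η (u x - v x)
  obtain ⟨hφc, hφs⟩ := indicator_comp_compactSupport hΩbdd hΩopen (huc.sub hvc)
    (fun x hx => sub_nonpos.2 (hbdry x hx)) hδ hη0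
  have hφ : ContDiff ℝ 1 φ :=
    contDiff_indicator_of_tsupport_subset hΩopen (hηc.comp_contDiffOn (hu1.sub hv1)) hφs
  have hφnn : ∀ x, 0 ≤ φ x := fun x =>
    Set.indicator_nonneg (fun y _ => Real.smoothTransition.nonneg _) x
  have hgrad : ∀ x ∈ Ω, gradient φ x
      = deriv η (u x - v x) • (gradient u x - gradient v x) := by
    intro x hx
    have hxo := hΩopen.mem_nhds hx
    have heq : φ =ᶠ[nhds x] fun y => η (u y - v y) :=
      Filter.eventuallyEq_of_mem hxo fun y hy => Set.indicator_of_mem hy _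
    rw [heq.gradient_eq]
    exact gradient_comp_sub (hηc.differentiable one_ne_zero _)
      ((hu1.contDiffAt hxo).differentiableAt one_ne_zero)
      ((hv1.contDiffAt hxo).differentiableAt one_ne_zero)
  have hpos : ∀ x ∈ Ω, gradient φ x ≠ 0 →
      0 < ⟪regNormal ε F u x - regNormal ε F v x, gradient φ x⟫ := by
    intro x hx hne
    rw [hgrad x hx] at hne ⊢
    obtain ⟨h1, h2⟩ := smul_ne_zero_iff.1 hne
    rw [real_inner_smul_right]
    exact mul_pos (lt_of_le_of_ne hηm.deriv_nonneg h1.symm)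
      (inner_regNormal_sub_pos hε (sub_ne_zero.1 h2))
  have hnn : 0 ≤ᵐ[volume.restrict Ω]
      fun x => ⟪regNormal ε F u x - regNormal ε F v x, gradient φ x⟫ := by
    filter_upwards [ae_restrict_mem hΩopen.measurableSet] with x hx
    by_cases h : gradient φ x = 0
    · simp [h]
    · exact (hpos x hx h).le
  have hint := (integrable_inner_regNormal_sub hε hFmeas u v hφ hφc).integrableOn (s := Ω)
  have hzero := (setIntegral_eq_zero_iff_of_nonneg_ae hnn hint).1
    (le_antisymm (hweak φ hφ hφc hφs hφnn) (integral_nonneg_of_ae hnn))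
  have hae : gradient φ =ᵐ[volume] 0 := by
    filter_upwards [(ae_restrict_iff' hΩopen.measurableSet).1 hzero] with x hx
    by_contra hne
    have hxΩ : x ∈ Ω := by
      by_contra hxΩ
      have hloc : φ =ᶠ[nhds x] fun _ => 0 :=
        notMem_tsupport_iff_eventuallyEq.1 fun h => hxΩ (hφs h)
      exact hne (by rw [hloc.gradient_eq, gradient_fun_const, Pi.zero_apply])
    exact (hpos x hxΩ hne).ne' (hx hxΩ)
  have hall := (hφ.continuous_gradient.ae_eq_iff_eq volume continuous_const).1 hae
  have hφ0 := eq_zero_of_gradient_eq_zero (hφ.differentiable one_ne_zero) hφc (congrFun hall)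
  have hx : φ x₀ = η (u x₀ - v x₀) := Set.indicator_of_mem hx₀ _
  rw [hφ0] at hx
  exact (Real.smoothTransition.pos_of_pos (by linarith : 0 < u x₀ - v x₀ - δ)).ne hx
end
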